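/- arXiv:1407.0559 — 4 statements merged into one kernel-verified Lean document; each statement's English description precedes it below -/
import Mathlib

section
/- Let R be a commutative Noetherian ring, a an ideal of R, M a finitely generated R-module, and n a non-negative integer. Then the set Ass_R(⊕_{i=0}^{f_a^n(M)} H^i_a(M)) ∩ { p ∈ Spec R : dim R/p ≥ n } is finite (when f_a^n(M) is finite). -/
open CategoryTheory

noncomputable section

/-- An `R`-module `M` is *in dimension `< n`* if there exists a finitely generated
submodule `N ⊆ M` such that `dim Supp (M/N) < n`. -/
def InDimLT (R : Type) [CommRing R] (M : Type) [AddCommGroup M] [Module R M] (n : ℕ) : Prop :=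
  ∃ N : Submodule R M, N.FG ∧ Order.krullDim (Module.support R (M ⧸ N)) < (n : WithBot ℕ∞)

/-- The `i`-th local cohomology module of `M` with support in the ideal `a`. -/
def locCoh (R : Type) [CommRing R] (a : Ideal R) (i : ℕ)
    (M : Type) [AddCommGroup M] [Module R M] : ModuleCat R :=
  (localCohomology a i).obj (ModuleCat.of R M)

/-- The finiteness dimension `f_a(M)`:  the least `i` such that `H^i_a(M)` is not
finitely generated (`∞` if there is no such `i`). -/
def finDim (R : Type) [CommRing R] (a : Ideal R)
    (M : Type) [AddCommGroup M] [Module R M] : ℕ∞ :=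
  sInf (Nat.cast '' {i : ℕ | ¬ Module.Finite R ↥(locCoh R a i M)})

/-- The `n`-th finiteness dimension `f_a^n(M)`. -/
def finDimN (R : Type) [CommRing R] (a : Ideal R) (n : ℕ)
    (M : Type) [AddCommGroup M] [Module R M] : ℕ∞ :=
  sInf {d : ℕ∞ | ∃ p : PrimeSpectrum R,
    p ∈ Module.support R (M ⧸ (a • ⊤ : Submodule R M)) ∧
    (n : WithBot ℕ∞) ≤ ringKrullDim (R ⧸ p.asIdeal) ∧
    d = finDim (Localization.AtPrime p.asIdeal)
      (a.map (algebraMap R (Localization.AtPrime p.asIdeal)))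
      (LocalizedModule p.asIdeal.primeCompl M)}

/-- `h_a^n(M)`: the least `i` such that `H^i_a(M)` is not in dimension `< n`. -/
def hDimN (R : Type) [CommRing R] (a : Ideal R) (n : ℕ)
    (M : Type) [AddCommGroup M] [Module R M] : ℕ∞ :=
  sInf (Nat.cast '' {i : ℕ | ¬ InDimLT R ↥(locCoh R a i M) n})

open DirectSum

namespace LeftDerivedSequence

open Limits HomologicalComplex

universe v u v' u'

variable {C : Type u} [Category.{v} C] {D : Type u'} [Category.{v'} D]
  [Abelian C] [HasProjectiveResolutions C] [Abelian D]
  (S : ShortComplex (C ⥤ D)) [S.X₁.Additive] [S.X₂.Additive] [S.X₃.Additive]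

/-- The short complex of chain complexes obtained by evaluating a short complex of additive
functors on a chain complex. -/
def complexSeq (K : ChainComplex C ℕ) : ShortComplex (ChainComplex D ℕ) :=
  ShortComplex.mk ((NatTrans.mapHomologicalComplex S.f (ComplexShape.down ℕ)).app K)
    ((NatTrans.mapHomologicalComplex S.g (ComplexShape.down ℕ)).app K) (by
      ext i
      exact congr_app S.zero (K.X i))

/-- The map of short complexes induced by a chain map. -/
def complexSeqMap {K L : ChainComplex C ℕ} (φ : K ⟶ L) : complexSeq S K ⟶ complexSeq S L where
  τ₁ := (S.X₁.mapHomologicalComplex _).map φ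
  τ₂ := (S.X₂.mapHomologicalComplex _).map φ
  τ₃ := (S.X₃.mapHomologicalComplex _).map φ
  comm₁₂ := (NatTrans.mapHomologicalComplex S.f (ComplexShape.down ℕ)).naturality φ
  comm₂₃ := (NatTrans.mapHomologicalComplex S.g (ComplexShape.down ℕ)).naturality φ

/-- A short complex of functors is short exact on projective objects. -/
def ExactOnProjectives : Prop :=
  ∀ P : C, Projective P → (S.map ((evaluation C D).obj P)).ShortExact

variable {S}

lemma complexSeq_shortExact (hS : ExactOnProjectives S) {X : C} (P : ProjectiveResolution X) :
    (complexSeq S P.complex).ShortExact :=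
  shortExact_of_degreewise_shortExact _ fun i => hS _ (P.projective i)

variable (S)

/-- Left derived functors of the first functor computed by a short complex of complexes. -/
def isoHomology₁ {X : C} (P : ProjectiveResolution X) (n : ℕ) :
    (S.X₁.leftDerived n).obj X ≅ (complexSeq S P.complex).X₁.homology n :=
  P.isoLeftDerivedObj S.X₁ n

/-- Left derived functors of the second functor computed by a short complex of complexes. -/
def isoHomology₂ {X : C} (P : ProjectiveResolution X) (n : ℕ) :
    (S.X₂.leftDerived n).obj X ≅ (complexSeq S P.complex).X₂.homology n :=
  P.isoLeftDerivedObj S.X₂ n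

/-- Left derived functors of the third functor computed by a short complex of complexes. -/
def isoHomology₃ {X : C} (P : ProjectiveResolution X) (n : ℕ) :
    (S.X₃.leftDerived n).obj X ≅ (complexSeq S P.complex).X₃.homology n :=
  P.isoLeftDerivedObj S.X₃ n

lemma isoHomology_comm₁₂ {X : C} (P : ProjectiveResolution X) (n : ℕ) :
    (isoHomology₁ S P n).hom ≫ homologyMap (complexSeq S P.complex).f n =
      (NatTrans.leftDerived S.f n).app X ≫ (isoHomology₂ S P n).hom := by
  rw [← Iso.comp_inv_eq, Category.assoc]
  exact (ProjectiveResolution.leftDerived_app_eq S.f P n).symm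

lemma isoHomology_comm₂₃ {X : C} (P : ProjectiveResolution X) (n : ℕ) :
    (isoHomology₂ S P n).hom ≫ homologyMap (complexSeq S P.complex).g n =
      (NatTrans.leftDerived S.g n).app X ≫ (isoHomology₃ S P n).hom := by
  rw [← Iso.comp_inv_eq, Category.assoc]
  exact (ProjectiveResolution.leftDerived_app_eq S.g P n).symm

section

variable {X Y : C} (f : X ⟶ Y) (P : ProjectiveResolution X) (Q : ProjectiveResolution Y)

lemma lift_comm_zero :
    (ProjectiveResolution.lift f P Q).f 0 ≫ Q.π.f 0 = P.π.f 0 ≫ f := by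
  rw [← HomologicalComplex.comp_f, ProjectiveResolution.lift_commutes,
    HomologicalComplex.comp_f, ChainComplex.single₀_map_f_zero]
  rfl

lemma isoHomology₁_inv_naturality (n : ℕ) :
    (isoHomology₁ S P n).inv ≫ (S.X₁.leftDerived n).map f =
      homologyMap (complexSeqMap S (ProjectiveResolution.lift f P Q)).τ₁ n ≫
        (isoHomology₁ S Q n).inv :=
  ProjectiveResolution.isoLeftDerivedObj_inv_naturality f P Q _ (lift_comm_zero f P Q) _ _

lemma isoHomology₃_hom_naturality (n : ℕ) :
    (S.X₃.leftDerived n).map f ≫ (isoHomology₃ S Q n).hom =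
      (isoHomology₃ S P n).hom ≫
        homologyMap (complexSeqMap S (ProjectiveResolution.lift f P Q)).τ₃ n :=
  ProjectiveResolution.isoLeftDerivedObj_hom_naturality f P Q _ (lift_comm_zero f P Q) _ _

end

variable {S} (hS : ExactOnProjectives S)

/-- The connecting morphism between left derived functors. -/
def connecting (n : ℕ) : S.X₃.leftDerived (n + 1) ⟶ S.X₁.leftDerived n where
  app X := (isoHomology₃ S (projectiveResolution X) (n + 1)).hom ≫
    (complexSeq_shortExact hS (projectiveResolution X)).δ (n + 1) n (ComplexShape.down_mk _ _ rfl) ≫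
      (isoHomology₁ S (projectiveResolution X) n).inv
  naturality X Y f := by
    rw [← Category.assoc, isoHomology₃_hom_naturality S f (projectiveResolution X)
        (projectiveResolution Y), Category.assoc, Category.assoc, Category.assoc,
      isoHomology₁_inv_naturality S f (projectiveResolution X) (projectiveResolution Y),
      HomologySequence.δ_naturality_assoc
        (complexSeqMap S (ProjectiveResolution.lift f (projectiveResolution X)
          (projectiveResolution Y))) (complexSeq_shortExact hS _) (complexSeq_shortExact hS _)]

lemma connecting_app_comp (n : ℕ) (X : C) :
    (connecting hS n).app X ≫ (isoHomology₁ S (projectiveResolution X) n).hom =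
      (isoHomology₃ S (projectiveResolution X) (n + 1)).hom ≫
        (complexSeq_shortExact hS (projectiveResolution X)).δ (n + 1) n
          (ComplexShape.down_mk _ _ rfl) := by
  simp [connecting]

variable (S) in
lemma leftDerived_comp_zero (n : ℕ) (X : C) : (NatTrans.leftDerived S.f n).app X ≫
    (NatTrans.leftDerived S.g n).app X = 0 := by
  rw [← cancel_mono (isoHomology₃ S (projectiveResolution X) n).hom, Category.assoc,
    ← isoHomology_comm₂₃, ← Category.assoc, ← isoHomology_comm₁₂, Category.assoc,
    ← homologyMap_comp, (complexSeq S (projectiveResolution X).complex).zero]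
  simp

lemma exact_middle (hS : ExactOnProjectives S) (n : ℕ) (X : C) :
    (ShortComplex.mk _ _ (leftDerived_comp_zero S n X)).Exact :=
  (ShortComplex.exact_iff_of_iso (ShortComplex.isoMk
    (isoHomology₁ S (projectiveResolution X) n) (isoHomology₂ S (projectiveResolution X) n)
    (isoHomology₃ S (projectiveResolution X) n) (isoHomology_comm₁₂ S _ n)
    (isoHomology_comm₂₃ S _ n))).2
    ((complexSeq_shortExact hS (projectiveResolution X)).homology_exact₂ n)

lemma map_comp_connecting (n : ℕ) (X : C) :
    (NatTrans.leftDerived S.g (n + 1)).app X ≫ (connecting hS n).app X = 0 := by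
  rw [← cancel_mono (isoHomology₁ S (projectiveResolution X) n).hom, Category.assoc,
    connecting_app_comp, ← Category.assoc, ← isoHomology_comm₂₃, Category.assoc,
    ShortComplex.ShortExact.comp_δ]
  simp

lemma exact_right (n : ℕ) (X : C) :
    (ShortComplex.mk _ _ (map_comp_connecting hS n X)).Exact :=
  (ShortComplex.exact_iff_of_iso (ShortComplex.isoMk
    (isoHomology₂ S (projectiveResolution X) (n + 1))
    (isoHomology₃ S (projectiveResolution X) (n + 1)) (isoHomology₁ S (projectiveResolution X) n)
    (isoHomology_comm₂₃ S _ (n + 1)) (connecting_app_comp hS n X).symm)).2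
    ((complexSeq_shortExact hS (projectiveResolution X)).homology_exact₃ (n + 1) n
      (ComplexShape.down_mk _ _ rfl))

lemma connecting_comp_map (n : ℕ) (X : C) :
    (connecting hS n).app X ≫ (NatTrans.leftDerived S.f n).app X = 0 := by
  rw [← cancel_mono (isoHomology₂ S (projectiveResolution X) n).hom, Category.assoc,
    ← isoHomology_comm₁₂, ← Category.assoc, connecting_app_comp, Category.assoc,
    ShortComplex.ShortExact.δ_comp]
  simp

lemma exact_left (n : ℕ) (X : C) :
    (ShortComplex.mk _ _ (connecting_comp_map hS n X)).Exact :=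
  (ShortComplex.exact_iff_of_iso (ShortComplex.isoMk
    (isoHomology₃ S (projectiveResolution X) (n + 1)) (isoHomology₁ S (projectiveResolution X) n)
    (isoHomology₂ S (projectiveResolution X) n)
    (connecting_app_comp hS n X).symm (isoHomology_comm₁₂ S _ n))).2
    ((complexSeq_shortExact hS (projectiveResolution X)).homology_exact₁ (n + 1) n
      (ComplexShape.down_mk _ _ rfl))

lemma isZero_leftDerived_of_preservesHomology (F : C ⥤ D) [F.Additive] [F.PreservesHomology]
    (n : ℕ) (X : C) : IsZero ((F.leftDerived (n + 1)).obj X) := by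
  refine IsZero.of_iso ?_ ((projectiveResolution X).isoLeftDerivedObj F (n + 1))
  erw [← HomologicalComplex.exactAt_iff_isZero_homology]
  exact ((projectiveResolution X).complex_exactAt_succ n).map F

end LeftDerivedSequence

namespace LocCohSequence

open Limits Opposite

variable {R : Type} [CommRing R]

/-- The contravariant functor `Hom(-, Y)`, viewed as a covariant functor to the opposite
category. -/
abbrev homTo (Y : ModuleCat.{0} R) : ModuleCat.{0} R ⥤ (ModuleCat.{0} R)ᵒᵖ :=
  ((linearYoneda R (ModuleCat.{0} R)).obj Y).rightOp

/-- The map `Hom(-, Y) ⟶ Hom(-, Z)` in the opposite category. -/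
abbrev homToMap {Y Z : ModuleCat.{0} R} (f : Y ⟶ Z) : homTo Z ⟶ homTo Y :=
  NatTrans.rightOp ((linearYoneda R (ModuleCat.{0} R)).map f)

/-- The short complex of functors `Hom(-, S)`. -/
def homSeq (S : ShortComplex (ModuleCat.{0} R)) :
    ShortComplex (ModuleCat.{0} R ⥤ (ModuleCat.{0} R)ᵒᵖ) :=
  ShortComplex.mk (X₁ := homTo S.X₃) (X₂ := homTo S.X₂) (X₃ := homTo S.X₁)
    (homToMap S.g) (homToMap S.f) (by
    ext X
    apply Quiver.Hom.unop_inj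
    ext (φ : X ⟶ S.X₁)
    change (φ ≫ S.f) ≫ S.g = 0
    simp)

instance (S : ShortComplex (ModuleCat.{0} R)) : (homSeq S).X₁.Additive :=
  inferInstanceAs (homTo _).Additive
instance (S : ShortComplex (ModuleCat.{0} R)) : (homSeq S).X₂.Additive :=
  inferInstanceAs (homTo _).Additive
instance (S : ShortComplex (ModuleCat.{0} R)) : (homSeq S).X₃.Additive :=
  inferInstanceAs (homTo _).Additive

lemma homSeq_exactOnProjectives {S : ShortComplex (ModuleCat.{0} R)} (hS : S.ShortExact) :
    LeftDerivedSequence.ExactOnProjectives (homSeq S) := by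
  intro P hP
  let T : ShortComplex (ModuleCat.{0} R) := S.map ((linearCoyoneda R _).obj (op P))
  have hT : T.ShortExact := by
    have := hS.mono_f
    have := hS.epi_g
    have h1 : Function.Injective T.f.hom := by
      intro (φ : P ⟶ S.X₁) (ψ : P ⟶ S.X₁) (h : φ ≫ S.f = ψ ≫ S.f)
      exact (cancel_mono _).1 h
    have h2 : Function.Surjective T.g.hom := by
      intro (φ : P ⟶ S.X₃)
      exact ⟨Projective.factorThru φ S.g, Projective.factorThru_comp φ S.g⟩
    refine ShortComplex.ShortExact.mk' ?_ ((ModuleCat.mono_iff_injective _).2 h1)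
      ((ModuleCat.epi_iff_surjective _).2 h2)
    rw [ShortComplex.moduleCat_exact_iff]
    intro (φ : P ⟶ S.X₂) (h : φ ≫ S.g = 0)
    exact ⟨hS.exact.lift φ h, hS.exact.lift_f φ h⟩
  exact hT.op

/-- The system `Ext^i(R/a^k, Y)` whose colimit is local cohomology. -/
abbrev extSystem (a : Ideal R) (i : ℕ) (Y : ModuleCat.{0} R) : (ℕᵒᵖ)ᵒᵖ ⥤ ModuleCat.{0} R :=
  localCohomology.diagram (localCohomology.idealPowersDiagram a) i ⋙ (evaluation _ _).obj Y

/-- The functoriality of `extSystem`. -/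
abbrev extSystemMap (a : Ideal R) (i : ℕ) {Y Z : ModuleCat.{0} R} (f : Y ⟶ Z) :
    extSystem a i Y ⟶ extSystem a i Z :=
  Functor.whiskerLeft (localCohomology.diagram (localCohomology.idealPowersDiagram a) i)
    ((evaluation _ _).map f)

/-- The cocone from the system of Ext modules to local cohomology. -/
def locCohCocone (a : Ideal R) (i : ℕ) (Y : ModuleCat.{0} R) : Cocone (extSystem a i Y) :=
  ((evaluation _ _).obj Y).mapCocone
    (colimit.cocone (localCohomology.diagram (localCohomology.idealPowersDiagram a) i))

/-- Local cohomology is the colimit of the Ext modules. -/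
def locCohCoconeIsColimit (a : Ideal R) (i : ℕ) (Y : ModuleCat.{0} R) :
    IsColimit (locCohCocone a i Y) :=
  isColimitOfPreserves _ (colimit.isColimit _)

lemma locCohCocone_map (a : Ideal R) (i : ℕ) {Y Z : ModuleCat.{0} R} (f : Y ⟶ Z) (k) :
    (locCohCocone a i Y).ι.app k ≫ (localCohomology a i).map f =
      (extSystemMap a i f).app k ≫ (locCohCocone a i Z).ι.app k :=
  (((colimit.cocone (localCohomology.diagram (localCohomology.idealPowersDiagram a) i)).ι.app
    k).naturality f).symm

variable {S : ShortComplex (ModuleCat.{0} R)} (hS : S.ShortExact) (a : Ideal R) (i : ℕ)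

/-- The connecting maps of Ext modules. -/
def extSystemδ : extSystem a i S.X₃ ⟶ extSystem a (i + 1) S.X₁ where
  app k := ((LeftDerivedSequence.connecting (homSeq_exactOnProjectives hS) i).app
    ((localCohomology.ringModIdeals (localCohomology.idealPowersDiagram a)).obj k.unop)).unop
  naturality k l φ := by
    apply Quiver.Hom.op_inj
    exact ((LeftDerivedSequence.connecting (homSeq_exactOnProjectives hS) i).naturality
      ((localCohomology.ringModIdeals (localCohomology.idealPowersDiagram a)).map φ.unop)).symm

/-- The connecting map of local cohomology. -/
def locCohδ : (localCohomology a i).obj S.X₃ ⟶ (localCohomology a (i + 1)).obj S.X₁ :=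
  (locCohCoconeIsColimit a i S.X₃).desc
    ⟨_, extSystemδ hS a i ≫ (locCohCocone a (i + 1) S.X₁).ι⟩

lemma locCohδ_comm (k) : (locCohCocone a i S.X₃).ι.app k ≫ locCohδ hS a i =
    (extSystemδ hS a i).app k ≫ (locCohCocone a (i + 1) S.X₁).ι.app k :=
  (locCohCoconeIsColimit a i S.X₃).fac _ k

/-- Exactness passes to filtered colimits. -/
lemma exact_colimit {F G H : (ℕᵒᵖ)ᵒᵖ ⥤ ModuleCat.{0} R} {c : Cocone F} {d : Cocone G} {e : Cocone H}
    (hc : IsColimit c) (hd : IsColimit d) (he : IsColimit e) (α : F ⟶ G) (β : G ⟶ H)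
    (h : ∀ k, Function.Exact (α.app k).hom (β.app k).hom)
    (f : c.pt ⟶ d.pt) (g : d.pt ⟶ e.pt) (hf : ∀ k, c.ι.app k ≫ f = α.app k ≫ d.ι.app k)
    (hg : ∀ k, d.ι.app k ≫ g = β.app k ≫ e.ι.app k) : Function.Exact f.hom g.hom := by
  have h0 : α ≫ β = 0 := by
    ext k x
    exact (h k _).2 ⟨x, rfl⟩
  have hE : (ShortComplex.mk α β h0).Exact := by
    rw [ShortComplex.exact_iff_isZero_homology]
    refine Functor.isZero _ fun k => ?_
    refine IsZero.of_iso ?_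
      ((ShortComplex.mk α β h0).mapHomologyIso ((evaluation _ (ModuleCat.{0} R)).obj k)).symm
    rw [← ShortComplex.exact_iff_isZero_homology]
    exact (ShortComplex.ShortExact.moduleCat_exact_iff_function_exact _).2 (h k)
  have := colim.exact_mapShortComplex hE hc hd he f g hf hg
  exact (ShortComplex.ShortExact.moduleCat_exact_iff_function_exact _).1 this

lemma exact_middle (hS : S.ShortExact) (a : Ideal R) (i : ℕ) :
    Function.Exact ((localCohomology a i).map S.f).hom
      ((localCohomology a i).map S.g).hom := by
  refine exact_colimit (locCohCoconeIsColimit a i S.X₁) (locCohCoconeIsColimit a i S.X₂)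
    (locCohCoconeIsColimit a i S.X₃) (extSystemMap a i S.f) (extSystemMap a i S.g) (fun k => ?_)
    _ _ (locCohCocone_map a i S.f) (locCohCocone_map a i S.g)
  exact (ShortComplex.ShortExact.moduleCat_exact_iff_function_exact _).1
    ((LeftDerivedSequence.exact_middle (homSeq_exactOnProjectives hS) i
      ((localCohomology.ringModIdeals (localCohomology.idealPowersDiagram a)).obj k.unop))).unop

lemma exact_right : Function.Exact ((localCohomology a i).map S.g).hom
    (locCohδ hS a i).hom := by
  refine exact_colimit (locCohCoconeIsColimit a i S.X₂) (locCohCoconeIsColimit a i S.X₃)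
    (locCohCoconeIsColimit a (i + 1) S.X₁) (extSystemMap a i S.g) (extSystemδ hS a i) (fun k => ?_)
    _ _ (locCohCocone_map a i S.g) (locCohδ_comm hS a i)
  exact (ShortComplex.ShortExact.moduleCat_exact_iff_function_exact _).1
    ((LeftDerivedSequence.exact_left (homSeq_exactOnProjectives hS) i
      ((localCohomology.ringModIdeals (localCohomology.idealPowersDiagram a)).obj k.unop))).unop

lemma exact_left : Function.Exact (locCohδ hS a i).hom
    ((localCohomology a (i + 1)).map S.f).hom := by
  refine exact_colimit (locCohCoconeIsColimit a i S.X₃)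
    (locCohCoconeIsColimit a (i + 1) S.X₁) (locCohCoconeIsColimit a (i + 1) S.X₂)
    (extSystemδ hS a i) (extSystemMap a (i + 1) S.f) (fun k => ?_)
    _ _ (locCohδ_comm hS a i) (locCohCocone_map a (i + 1) S.f)
  exact (ShortComplex.ShortExact.moduleCat_exact_iff_function_exact _).1
    ((LeftDerivedSequence.exact_right (homSeq_exactOnProjectives hS) i
      ((localCohomology.ringModIdeals (localCohomology.idealPowersDiagram a)).obj k.unop))).unop

end LocCohSequence

namespace LeftDerivedSequence

open Limits HomologicalComplex

universe v u v' u'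

variable {C : Type u} [Category.{v} C] {D : Type u'} [Category.{v'} D]
  [Abelian C] [HasProjectiveResolutions C] [Abelian D] {F G : C ⥤ D} [F.Additive] [G.Additive]

lemma fromLeftDerivedZero_naturality (α : F ⟶ G) (X : C) :
    (NatTrans.leftDerived α 0).app X ≫ G.fromLeftDerivedZero.app X =
      F.fromLeftDerivedZero.app X ≫ α.app X := by
  let P := projectiveResolution X
  have h0 : HomologicalComplex.opcyclesMap
      ((NatTrans.mapHomologicalComplex α (ComplexShape.down ℕ)).app P.complex) 0 ≫
      P.fromLeftDerivedZero' G = P.fromLeftDerivedZero' F ≫ α.app X := by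
    rw [← cancel_epi (HomologicalComplex.pOpcycles _ _), HomologicalComplex.p_opcyclesMap_assoc,
      ProjectiveResolution.pOpcycles_comp_fromLeftDerivedZero',
      ProjectiveResolution.pOpcycles_comp_fromLeftDerivedZero'_assoc]
    exact (α.naturality (P.π.f 0)).symm
  rw [P.fromLeftDerivedZero_eq, P.fromLeftDerivedZero_eq,
    ProjectiveResolution.leftDerived_app_eq α P 0]
  simp only [Category.assoc, Iso.inv_hom_id_assoc]
  refine congrArg (fun t => (P.isoLeftDerivedObj F 0).hom ≫ t) ?_
  exact (HomologicalComplex.homologyι_naturality_assoc _ 0 _).trans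
    ((congrArg (fun t => HomologicalComplex.homologyι _ 0 ≫ t) h0).trans (Category.assoc _ _ _).symm)

end LeftDerivedSequence

namespace LocCohSequence

open Limits Opposite

variable {R : Type} [CommRing R]

/-- The linear structure on the opposite of a linear category. -/
@[reducible] def linearOpposite (C : Type*) [Category* C] [Preadditive C] [Linear R C] :
    Linear R Cᵒᵖ where
  homModule _ _ :=
    { smul := fun r f => (r • f.unop).op
      one_smul := fun f => Quiver.Hom.unop_inj (one_smul R f.unop)
      mul_smul := fun r s f => Quiver.Hom.unop_inj (mul_smul r s f.unop)
      smul_zero := fun r => Quiver.Hom.unop_inj (smul_zero r)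
      smul_add := fun r f g => Quiver.Hom.unop_inj (smul_add r f.unop g.unop)
      add_smul := fun r s f => Quiver.Hom.unop_inj (add_smul r s f.unop)
      zero_smul := fun f => Quiver.Hom.unop_inj (zero_smul R f.unop) }
  smul_comp _ _ _ r f g := Quiver.Hom.unop_inj (Linear.comp_smul _ _ _ g.unop r f.unop)
  comp_smul _ _ _ f r g := Quiver.Hom.unop_inj (Linear.smul_comp _ _ _ r g.unop f.unop)

lemma leftDerived_homToMap_smul (Y : ModuleCat.{0} R) (r : R) (i : ℕ) (X : ModuleCat.{0} R) :
    ((NatTrans.leftDerived (homToMap (r • 𝟙 Y)) i).app X).unop = r • 𝟙 _ := by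
  let _ := linearOpposite (R := R) (ModuleCat.{0} R)
  have key : (NatTrans.leftDerived (homToMap (r • 𝟙 Y)) i).app X = r • 𝟙 _ := by
    let P := projectiveResolution X
    have h0 : (HomologicalComplex.shortComplexFunctor _ _ i).map
        ((NatTrans.mapHomologicalComplex (homToMap (r • 𝟙 Y)) (ComplexShape.down ℕ)).app P.complex)
        = r • 𝟙 _ := by
      ext <;>
      · apply Quiver.Hom.unop_inj
        ext φ
        exact Linear.comp_smul _ _ _ φ r (𝟙 Y) |>.trans (congrArg _ (Category.comp_id φ))
    rw [ProjectiveResolution.leftDerived_app_eq _ P i]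
    have h1 : (HomologicalComplex.homologyFunctor (ModuleCat.{0} R)ᵒᵖ (ComplexShape.down ℕ) i).map
        ((NatTrans.mapHomologicalComplex (homToMap (r • 𝟙 Y)) (ComplexShape.down ℕ)).app P.complex)
        = r • 𝟙 _ := by
      refine (congrArg (fun t => ShortComplex.homologyMap t) h0).trans ?_
      rw [ShortComplex.homologyMap_smul, ShortComplex.homologyMap_id]
      rfl
    rw [h1]
    simp
  rw [key]
  rfl

variable (a : Ideal R)

lemma map_smul_id (i : ℕ) (Y : ModuleCat.{0} R) (r : R) :
    (localCohomology a i).map (r • 𝟙 Y) = r • 𝟙 _ := by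
  refine (locCohCoconeIsColimit a i Y).hom_ext fun k => ?_
  rw [locCohCocone_map]
  have h : (extSystemMap a i (r • 𝟙 Y)).app k = r • 𝟙 _ :=
    leftDerived_homToMap_smul Y r i
      ((localCohomology.ringModIdeals (localCohomology.idealPowersDiagram a)).obj k.unop)
  rw [h]
  simp
  rfl

instance (Y : ModuleCat.{0} R) : PreservesFiniteColimits (homTo Y) := by
  refine ((homTo Y).preservesFiniteColimits_tfae.out 0 3).1 fun S hS => ?_
  have := hS.mono_f
  have := hS.epi_g
  let T : ShortComplex (ModuleCat.{0} R) :=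
    ShortComplex.mk (((linearYoneda R _).obj Y).map S.g.op) (((linearYoneda R _).obj Y).map S.f.op)
      (by
        ext (φ : S.X₃ ⟶ Y)
        change S.f ≫ S.g ≫ φ = 0
        simp)
  have hT : T.Exact := by
    rw [ShortComplex.moduleCat_exact_iff]
    intro (φ : S.X₂ ⟶ Y) (h : S.f ≫ φ = 0)
    exact ⟨hS.exact.desc φ h, hS.exact.g_desc φ h⟩
  have h1 : Mono T.f := (ModuleCat.mono_iff_injective _).2 (by
      intro (φ : S.X₃ ⟶ Y) (ψ : S.X₃ ⟶ Y) (h : S.g ≫ φ = S.g ≫ ψ)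
      exact (cancel_epi _).1 h)
  exact ⟨hT.op, (inferInstance : Epi T.f.op)⟩

lemma homTo_preservesHomology (Y : ModuleCat.{0} R) [Injective Y] :
    (homTo Y).PreservesHomology := by
  have ht := ((homTo Y).exact_tfae.out 0 2)
  refine ht.1 fun S hS => ?_
  have ht' := ((homTo Y).preservesFiniteColimits_tfae.out 0 3)
  have h := ht'.2 inferInstance S hS
  have := hS.mono_f
  have hs : Function.Surjective (((linearYoneda R _).obj Y).map S.f.op).hom := by
    intro (φ : S.X₁ ⟶ Y)
    exact ⟨Injective.factorThru φ S.f, Injective.comp_factorThru φ S.f⟩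
  have he : Epi (((linearYoneda R _).obj Y).map S.f.op) := (ModuleCat.epi_iff_surjective _).2 hs
  exact ShortComplex.ShortExact.mk' h.1 (inferInstance : Mono (((linearYoneda R _).obj Y).map S.f.op).op) h.2

lemma subsingleton_of_injective (i : ℕ) (Y : ModuleCat.{0} R) [Injective Y] :
    Subsingleton ((localCohomology a (i + 1)).obj Y) := by
  have := homTo_preservesHomology Y
  have h : ∀ x : (localCohomology a (i + 1)).obj Y, x = 0 := by
    intro x
    obtain ⟨k, u, rfl⟩ := Concrete.isColimit_exists_rep _ (locCohCoconeIsColimit a (i + 1) Y) x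
    have hz : IsZero ((extSystem a (i + 1) Y).obj k) :=
      (LeftDerivedSequence.isZero_leftDerived_of_preservesHomology (homTo Y) i
        ((localCohomology.ringModIdeals (localCohomology.idealPowersDiagram a)).obj k.unop)).unop
    have := ModuleCat.subsingleton_of_isZero hz
    rw [Subsingleton.elim u 0]
    exact map_zero ((locCohCocone a (i + 1) Y).ι.app k).hom
  exact ⟨fun x y => (h x).trans (h y).symm⟩

/-- Evaluation at one of homomorphisms from a quotient of the ring. -/
def evalOne (Y : ModuleCat.{0} R) (I : Ideal R) :
    ((linearYoneda R (ModuleCat.{0} R)).obj Y).obj (op (ModuleCat.of R (R ⧸ I))) ⟶ Y :=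
  ModuleCat.ofHom (X := (ModuleCat.of R (R ⧸ I) ⟶ Y)) (Y := Y)
    { toFun := fun φ => φ.hom (1 : R ⧸ I)
      map_add' := fun _ _ => rfl
      map_smul' := fun _ _ => rfl }

lemma evalOne_injective (Y : ModuleCat.{0} R) (I : Ideal R) :
    Function.Injective (evalOne Y I).hom := by
  intro (φ : ModuleCat.of R (R ⧸ I) ⟶ Y) (ψ : ModuleCat.of R (R ⧸ I) ⟶ Y)
    (h : φ.hom (1 : R ⧸ I) = ψ.hom (1 : R ⧸ I))
  apply ModuleCat.hom_ext
  refine Submodule.linearMap_qext _ (LinearMap.ext_ring h)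

lemma mem_range_evalOne (Y : ModuleCat.{0} R) (I : Ideal R) (y : Y) :
    (∃ φ, (evalOne Y I).hom φ = y) ↔ ∀ r ∈ I, r • y = 0 := by
  constructor
  · rintro ⟨φ, rfl⟩ r hr
    change r • (ModuleCat.Hom.hom (show ModuleCat.of R (R ⧸ I) ⟶ Y from φ)) (1 : R ⧸ I) = 0
    rw [← map_smul, Algebra.smul_def, mul_one, Ideal.Quotient.algebraMap_eq,
      Ideal.Quotient.eq_zero_iff_mem.2 hr, map_zero]
  · intro h
    refine ⟨ModuleCat.ofHom (Submodule.liftQ I (LinearMap.toSpanSingleton R Y y) fun r hr => h r hr), ?_⟩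
    change (Submodule.liftQ I (LinearMap.toSpanSingleton R Y y) fun r hr => h r hr)
      (Submodule.Quotient.mk 1) = y
    exact (Submodule.liftQ_apply _ _ _).trans (one_smul R y)

/-- The isomorphism between the zeroth Ext module and homomorphisms. -/
def extZeroIso (Y : ModuleCat.{0} R) (k : (ℕᵒᵖ)ᵒᵖ) : (extSystem a 0 Y).obj k ≅
    ((linearYoneda R (ModuleCat.{0} R)).obj Y).obj
      (op ((localCohomology.ringModIdeals (localCohomology.idealPowersDiagram a)).obj k.unop)) :=
  ((homTo Y).leftDerivedZeroIsoSelf.app ((localCohomology.ringModIdeals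
    (localCohomology.idealPowersDiagram a)).obj k.unop)).unop.symm

lemma extZeroIso_naturality (Y : ModuleCat.{0} R) {k l : (ℕᵒᵖ)ᵒᵖ} (φ : k ⟶ l) :
    (extSystem a 0 Y).map φ ≫ (extZeroIso a Y l).hom = (extZeroIso a Y k).hom ≫
      ((linearYoneda R (ModuleCat.{0} R)).obj Y).map
        ((localCohomology.ringModIdeals (localCohomology.idealPowersDiagram a)).map φ.unop).op := by
  rw [← Iso.inv_comp_eq, ← Category.assoc, ← Iso.eq_comp_inv]
  apply Quiver.Hom.op_inj
  exact (homTo Y).fromLeftDerivedZero.naturality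
    ((localCohomology.ringModIdeals (localCohomology.idealPowersDiagram a)).map φ.unop)

lemma extZeroIso_map {Y Z : ModuleCat.{0} R} (f : Y ⟶ Z) (k : (ℕᵒᵖ)ᵒᵖ) :
    (extSystemMap a 0 f).app k ≫ (extZeroIso a Z k).hom = (extZeroIso a Y k).hom ≫
      ((linearYoneda R (ModuleCat.{0} R)).map f).app
        (op ((localCohomology.ringModIdeals (localCohomology.idealPowersDiagram a)).obj k.unop)) := by
  rw [← Iso.inv_comp_eq, ← Category.assoc, ← Iso.eq_comp_inv]
  apply Quiver.Hom.op_inj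
  exact (LeftDerivedSequence.fromLeftDerivedZero_naturality (homToMap f)
    ((localCohomology.ringModIdeals (localCohomology.idealPowersDiagram a)).obj k.unop))

/-- The natural map from the zeroth local cohomology to the module. -/
def zeroEval (Y : ModuleCat.{0} R) : (localCohomology a 0).obj Y ⟶ Y :=
  (locCohCoconeIsColimit a 0 Y).desc
    { pt := Y
      ι :=
        { app := fun k => (extZeroIso a Y k).hom ≫ evalOne Y _
          naturality := fun k l φ => by
            ext u
            exact congrArg (evalOne Y (a ^ l.unop.unop)).hom
              (congrArg (fun t => t.hom u) (extZeroIso_naturality a Y φ)) } }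

lemma cocone_zeroEval (Y : ModuleCat.{0} R) (k) :
    (locCohCocone a 0 Y).ι.app k ≫ zeroEval a Y = (extZeroIso a Y k).hom ≫ evalOne Y _ :=
  (locCohCoconeIsColimit a 0 Y).fac _ k

lemma zeroEval_ι_apply (Y : ModuleCat.{0} R) (k) (u : (extSystem a 0 Y).obj k) :
    (zeroEval a Y).hom (((locCohCocone a 0 Y).ι.app k).hom u) =
      (evalOne Y _).hom ((extZeroIso a Y k).hom.hom u) :=
  congrArg (fun t => t.hom u) (cocone_zeroEval a Y k)

lemma zeroEval_naturality {Y Z : ModuleCat.{0} R} (f : Y ⟶ Z)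
    (x : (localCohomology a 0).obj Y) :
    (zeroEval a Z).hom (((localCohomology a 0).map f).hom x) = f.hom ((zeroEval a Y).hom x) := by
  obtain ⟨k, u, rfl⟩ := Concrete.isColimit_exists_rep _ (locCohCoconeIsColimit a 0 Y) x
  have h1 : ((localCohomology a 0).map f).hom (((locCohCocone a 0 Y).ι.app k).hom u) =
      ((locCohCocone a 0 Z).ι.app k).hom (((extSystemMap a 0 f).app k).hom u) :=
    congrArg (fun t => t.hom u) (locCohCocone_map a 0 f k)
  have h2 : (extZeroIso a Z k).hom.hom (((extSystemMap a 0 f).app k).hom u) =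
      (((linearYoneda R (ModuleCat.{0} R)).map f).app
        (op ((localCohomology.ringModIdeals
          (localCohomology.idealPowersDiagram a)).obj k.unop))).hom
        ((extZeroIso a Y k).hom.hom u) :=
    congrArg (fun t => t.hom u) (extZeroIso_map a f k)
  refine (congrArg _ h1).trans ((zeroEval_ι_apply a Z k _).trans ((congrArg _ h2).trans ?_))
  exact congrArg f.hom (zeroEval_ι_apply a Y k u).symm

lemma zeroEval_injective (Y : ModuleCat.{0} R) : Function.Injective (zeroEval a Y).hom := by
  rw [injective_iff_map_eq_zero]
  intro x hx
  obtain ⟨k, u, rfl⟩ := Concrete.isColimit_exists_rep _ (locCohCoconeIsColimit a 0 Y) x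
  have h1 : (evalOne Y _).hom ((extZeroIso a Y k).hom.hom u) = 0 :=
    (zeroEval_ι_apply a Y k u).symm.trans hx
  have h2 : (extZeroIso a Y k).hom.hom u = 0 :=
    evalOne_injective Y _ (h1.trans (map_zero _).symm)
  have h3 : u = 0 := by
    have := congrArg (extZeroIso a Y k).inv.hom h2
    rw [map_zero] at this
    rw [← this]
    exact (congrArg (fun t => t.hom u) (extZeroIso a Y k).hom_inv_id).symm
  rw [h3]
  exact map_zero ((locCohCocone a 0 Y).ι.app k).hom

lemma mem_range_zeroEval (Y : ModuleCat.{0} R) (y : Y) :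
    (∃ x, (zeroEval a Y).hom x = y) ↔ ∃ k : ℕ, ∀ r ∈ a ^ k, r • y = 0 := by
  constructor
  · rintro ⟨x, rfl⟩
    obtain ⟨k, u, rfl⟩ := Concrete.isColimit_exists_rep _ (locCohCoconeIsColimit a 0 Y) x
    exact ⟨k.unop.unop, (mem_range_evalOne Y _ _).1
      ⟨(extZeroIso a Y k).hom.hom u, (zeroEval_ι_apply a Y k u).symm⟩⟩
  · rintro ⟨k, hk⟩
    obtain ⟨φ, hφ⟩ := (mem_range_evalOne Y _ _).2 hk
    refine ⟨((locCohCocone a 0 Y).ι.app (op (op k))).hom ((extZeroIso a Y (op (op k))).inv.hom φ), ?_⟩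
    rw [zeroEval_ι_apply, ← hφ]
    exact congrArg _ (congrArg (fun t => t.hom φ) (extZeroIso a Y (op (op k))).inv_hom_id)

end LocCohSequence

namespace LocCoh

variable {R : Type} [CommRing R] (a : Ideal R) (i : ℕ)
  {A B C : Type} [AddCommGroup A] [Module R A] [AddCommGroup B] [Module R B]
  [AddCommGroup C] [Module R C]

/-- Functoriality of local cohomology on linear maps. -/
def map (f : A →ₗ[R] B) : locCoh R a i A →ₗ[R] locCoh R a i B :=
  ((localCohomology a i).map (ModuleCat.ofHom f)).hom

lemma map_id : map a i (LinearMap.id : A →ₗ[R] A) = LinearMap.id := by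
  have : ModuleCat.ofHom (LinearMap.id : A →ₗ[R] A) = 𝟙 _ := rfl
  rw [map, this, CategoryTheory.Functor.map_id]
  rfl

lemma map_comp (f : A →ₗ[R] B) (g : B →ₗ[R] C) :
    map a i (g ∘ₗ f) = map a i g ∘ₗ map a i f := by
  rw [map, ModuleCat.ofHom_comp, CategoryTheory.Functor.map_comp]
  rfl

lemma map_smul_id (r : R) :
    map a i (r • LinearMap.id : A →ₗ[R] A) = r • LinearMap.id :=
  congrArg ModuleCat.Hom.hom (LocCohSequence.map_smul_id a i (ModuleCat.of R A) r)

section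

variable {f : A →ₗ[R] B} {g : B →ₗ[R] C}

/-- A short exact sequence of modules as a short complex. -/
abbrev seq (h : Function.Exact f g) : ShortComplex (ModuleCat.{0} R) :=
  ShortComplex.mk (ModuleCat.ofHom f) (ModuleCat.ofHom g)
    (by ext x; exact (h _).2 ⟨x, rfl⟩)

lemma seq_shortExact (hf : Function.Injective f) (hg : Function.Surjective g)
    (h : Function.Exact f g) : (seq h).ShortExact :=
  ShortComplex.ShortExact.mk' ((ShortComplex.ShortExact.moduleCat_exact_iff_function_exact _).2 h)
    ((ModuleCat.mono_iff_injective _).2 hf) ((ModuleCat.epi_iff_surjective _).2 hg)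

lemma exact_map (hf : Function.Injective f) (hg : Function.Surjective g)
    (h : Function.Exact f g) : Function.Exact (map a i f) (map a i g) :=
  LocCohSequence.exact_middle (seq_shortExact hf hg h) a i

lemma exists_connecting (hf : Function.Injective f) (hg : Function.Surjective g)
    (h : Function.Exact f g) : ∃ δ : locCoh R a i C →ₗ[R] locCoh R a (i + 1) A,
    Function.Exact (map a i g) δ ∧ Function.Exact δ (map a (i + 1) f) :=
  ⟨(LocCohSequence.locCohδ (seq_shortExact hf hg h) a i).hom,
    LocCohSequence.exact_right (seq_shortExact hf hg h) a i,
    LocCohSequence.exact_left (seq_shortExact hf hg h) a i⟩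

end

/-- The inclusion of the zeroth local cohomology into the module. -/
def zeroIncl (A : Type) [AddCommGroup A] [Module R A] : locCoh R a 0 A →ₗ[R] A :=
  (LocCohSequence.zeroEval a (ModuleCat.of R A)).hom

lemma zeroIncl_injective : Function.Injective (zeroIncl a A) :=
  LocCohSequence.zeroEval_injective a (ModuleCat.of R A)

/-- The elements of a module annihilated by a power of an ideal. -/
def torsion (A : Type) [AddCommGroup A] [Module R A] : Submodule R A where
  carrier := {x | ∃ k : ℕ, ∀ r ∈ a ^ k, r • x = 0}
  zero_mem' := ⟨0, fun r _ => smul_zero r⟩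
  add_mem' := by
    rintro x y ⟨k, hk⟩ ⟨l, hl⟩
    refine ⟨k + l, fun r hr => ?_⟩
    rw [smul_add, hk r (Ideal.pow_le_pow_right (Nat.le_add_right _ _) hr),
      hl r (Ideal.pow_le_pow_right (Nat.le_add_left _ _) hr), add_zero]
  smul_mem' := by
    rintro s x ⟨k, hk⟩
    exact ⟨k, fun r hr => by rw [smul_comm, hk r hr, smul_zero]⟩

lemma range_zeroIncl : (zeroIncl a A).range = torsion a A := by
  ext x
  exact LocCohSequence.mem_range_zeroEval a (ModuleCat.of R A) x

lemma zeroIncl_mem_torsion (x : locCoh R a 0 A) : zeroIncl a A x ∈ torsion a A :=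
  (range_zeroIncl a).le ⟨x, rfl⟩

lemma zeroIncl_map (f : A →ₗ[R] B) (x : locCoh R a 0 A) :
    zeroIncl a B (map a 0 f x) = f (zeroIncl a A x) :=
  LocCohSequence.zeroEval_naturality a (ModuleCat.ofHom f) x

lemma subsingleton_of_injective [Module.Injective R A] :
    Subsingleton (locCoh R a (i + 1) A) := by
  have : Injective (ModuleCat.of R A) := Module.injective_object_of_injective_module R A
  exact LocCohSequence.subsingleton_of_injective a i (ModuleCat.of R A)

variable (R A) in
lemma exists_injective : ∃ (E : Type) (_ : AddCommGroup E) (_ : Module R E)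
    (f : A →ₗ[R] E), Module.Injective R E ∧ Function.Injective f := by
  let E := Injective.under (ModuleCat.of R A)
  refine ⟨E, inferInstance, inferInstance, (Injective.ι (ModuleCat.of R A)).hom, ?_, ?_⟩
  · have : Injective (ModuleCat.of R E) := inferInstanceAs (Injective E)
    exact Module.injective_module_of_injective_object R E
  · exact (ModuleCat.mono_iff_injective _).1 inferInstance

end LocCoh

namespace LocCoh

section General

variable {R : Type} [CommRing R] (a : Ideal R)
  {A B C : Type} [AddCommGroup A] [Module R A] [AddCommGroup B] [Module R B]
  [AddCommGroup C] [Module R C]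

lemma exists_pow_smul_eq_zero {N : Submodule R A} (hN : N.FG) (h : N ≤ torsion a A) :
    ∃ k : ℕ, ∀ r ∈ a ^ k, ∀ x ∈ N, r • x = 0 := by
  induction N, hN using Submodule.fg_induction with
  | singleton x =>
    obtain ⟨k, hk⟩ := h (Submodule.mem_span_singleton_self x)
    refine ⟨k, fun r hr y hy => ?_⟩
    obtain ⟨s, rfl⟩ := Submodule.mem_span_singleton.1 hy
    rw [smul_comm, hk r hr, smul_zero]
  | sup N₁ N₂ h₁ h₂ ih₁ ih₂ =>
    obtain ⟨k, hk⟩ := ih₁ (le_sup_left.trans h)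
    obtain ⟨l, hl⟩ := ih₂ (le_sup_right.trans h)
    refine ⟨k + l, fun r hr x hx => ?_⟩
    obtain ⟨y, hy, z, hz, rfl⟩ := Submodule.mem_sup.1 hx
    rw [smul_add, hk r (Ideal.pow_le_pow_right (Nat.le_add_right _ _) hr) _ hy,
      hl r (Ideal.pow_le_pow_right (Nat.le_add_left _ _) hr) _ hz, add_zero]

lemma map_mem_torsion (f : A →ₗ[R] B) {x : A} (hx : x ∈ torsion a A) : f x ∈ torsion a B := by
  obtain ⟨k, hk⟩ := hx
  exact ⟨k, fun r hr => by rw [← _root_.map_smul, hk r hr, _root_.map_zero]⟩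

lemma mem_torsion_of_map {f : A →ₗ[R] B} (hf : Function.Injective f) {x : A}
    (hx : f x ∈ torsion a B) : x ∈ torsion a A := by
  obtain ⟨k, hk⟩ := hx
  exact ⟨k, fun r hr => hf (by rw [_root_.map_smul, hk r hr, _root_.map_zero])⟩

lemma surjective_of_injective {i : ℕ} [Module.Injective R B] {f : A →ₗ[R] B}
    {δ : locCoh R a i C →ₗ[R] locCoh R a (i + 1) A} (h : Function.Exact δ (map a (i + 1) f)) :
    Function.Surjective δ := fun x => by
  have := subsingleton_of_injective (A := B) a i
  exact (h x).1 (Subsingleton.elim _ _)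

lemma mem_torsion_locCoh (i : ℕ) (A : Type) [AddCommGroup A] [Module R A] (x : locCoh R a i A) :
    x ∈ torsion a (locCoh R a i A) := by
  induction i generalizing A with
  | zero =>
    exact mem_torsion_of_map a (zeroIncl_injective a) (zeroIncl_mem_torsion a x)
  | succ i ih =>
    obtain ⟨E, _, _, f, hE, hf⟩ := exists_injective R A
    obtain ⟨δ, -, hδ⟩ := exists_connecting a i hf f.range.mkQ_surjective
      (LinearMap.exact_map_mkQ_range f)
    obtain ⟨y, rfl⟩ := surjective_of_injective a hδ x
    exact map_mem_torsion a δ (ih _ y)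

variable [IsNoetherianRing R]

lemma injective_torsion [Module.Injective R A] : Module.Injective R (torsion a A) := by
  apply Module.Baer.injective
  intro I g
  obtain ⟨k, hk⟩ : ∃ k : ℕ, ∀ r ∈ a ^ k, ∀ x : I, r • g x = 0 := by
    have hfg : (LinearMap.range g).FG := by
      rw [LinearMap.range_eq_map]
      exact (Module.Finite.fg_top).map g
    obtain ⟨k, hk⟩ := exists_pow_smul_eq_zero a hfg (fun x _ =>
      mem_torsion_of_map a (torsion a A).injective_subtype x.2)
    exact ⟨k, fun r hr x => hk r hr _ ⟨x, rfl⟩⟩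
  obtain ⟨l, hl⟩ := a.exists_pow_inf_eq_pow_smul (I : Submodule R R)
  have hvan : ∀ x : I, (x : R) ∈ a ^ (l + k) → g x = 0 := by
    intro x hx
    have h1 : (x : R) ∈ a ^ k • (I : Submodule R R) := by
      have h2 : (x : R) ∈ a ^ (l + k) • (⊤ : Submodule R R) ⊓ I := ⟨by simpa using hx, x.2⟩
      rw [hl (l + k) (Nat.le_add_right _ _), Nat.add_sub_cancel_left] at h2
      exact Submodule.smul_mono le_rfl inf_le_right h2
    have h3 : ∀ y ∈ a ^ k • (I : Submodule R R), ∃ hy : y ∈ I, g ⟨y, hy⟩ = 0 := by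
      intro y hy
      induction hy using Submodule.smul_induction_on' with
      | smul r hr z hz =>
        refine ⟨I.mul_mem_left r hz, ?_⟩
        rw [← hk r hr ⟨z, hz⟩, ← _root_.map_smul]
        rfl
      | add y hy z hz ihy ihz =>
        obtain ⟨hy, hy'⟩ := ihy
        obtain ⟨hz, hz'⟩ := ihz
        refine ⟨I.add_mem hy hz, ?_⟩
        have := map_add g ⟨y, hy⟩ ⟨z, hz⟩
        rw [hy', hz', add_zero] at this
        exact this
    exact (h3 _ h1).2
  let φ : I →ₗ[R] R ⧸ a ^ (l + k) := (Submodule.mkQ (a ^ (l + k))) ∘ₗ Submodule.subtype I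
  have hφ : LinearMap.ker φ ≤ LinearMap.ker ((torsion a A).subtype ∘ₗ g) := by
    intro x hx
    have : (x : R) ∈ a ^ (l + k) := (Submodule.Quotient.mk_eq_zero _).1 hx
    rw [LinearMap.mem_ker, LinearMap.comp_apply, hvan x this, _root_.map_zero]
  obtain ⟨h, hh⟩ := Module.Injective.out ((LinearMap.ker φ).liftQ φ le_rfl)
    (LinearMap.ker_eq_bot.1 (Submodule.ker_liftQ_eq_bot _ _ _ le_rfl))
    ((LinearMap.ker φ).liftQ _ hφ)
  have hz : ∀ r : R, r • h (Submodule.Quotient.mk 1) = h (Submodule.Quotient.mk r) := by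
    intro r
    rw [← _root_.map_smul, ← Submodule.Quotient.mk_smul, smul_eq_mul, mul_one]
  refine ⟨LinearMap.toSpanSingleton R _ ⟨h (Submodule.Quotient.mk 1), l + k, fun r hr => ?_⟩,
    fun x hx => ?_⟩
  · rw [hz, (Submodule.Quotient.mk_eq_zero _).2 hr, _root_.map_zero]
  · apply Subtype.ext
    refine (hz x).trans ?_
    exact hh (Submodule.Quotient.mk ⟨x, hx⟩)

lemma subsingleton_of_torsion (i : ℕ) (A : Type) [AddCommGroup A] [Module R A]
    (hA : ∀ x : A, x ∈ torsion a A) : Subsingleton (locCoh R a (i + 1) A) := by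
  induction i generalizing A with
  | zero =>
    obtain ⟨E, _, _, f, hE, hf⟩ := exists_injective R A
    have := injective_torsion (A := E) a
    let f' : A →ₗ[R] torsion a E := f.codRestrict _ fun x => map_mem_torsion a f (hA x)
    have hf' : Function.Injective f' := fun x y hxy => hf (congrArg Subtype.val hxy)
    obtain ⟨δ, h1, hδ⟩ := exists_connecting a 0 hf' f'.range.mkQ_surjective
      (LinearMap.exact_map_mkQ_range f')
    refine subsingleton_of_forall_eq 0 fun x => ?_
    obtain ⟨c, rfl⟩ := surjective_of_injective a hδ x
    obtain ⟨g, hg⟩ := f'.range.mkQ_surjective (zeroIncl a _ c)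
    obtain ⟨g', hg'⟩ : g ∈ (zeroIncl a (torsion a E)).range := by
      rw [range_zeroIncl]
      exact mem_torsion_of_map a (torsion a E).injective_subtype g.2
    refine (h1 c).2 ⟨g', zeroIncl_injective a ?_⟩
    rw [zeroIncl_map, hg', hg]
  | succ i ih =>
    obtain ⟨E, _, _, f, hE, hf⟩ := exists_injective R A
    have := injective_torsion (A := E) a
    let f' : A →ₗ[R] torsion a E := f.codRestrict _ fun x => map_mem_torsion a f (hA x)
    have hf' : Function.Injective f' := fun x y hxy => hf (congrArg Subtype.val hxy)
    obtain ⟨δ, h1, hδ⟩ := exists_connecting a (i + 1) hf' f'.range.mkQ_surjective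
      (LinearMap.exact_map_mkQ_range f')
    have := ih (torsion a E ⧸ f'.range) (fun x => by
      obtain ⟨y, rfl⟩ := f'.range.mkQ_surjective x
      exact map_mem_torsion a _ (mem_torsion_of_map a (torsion a E).injective_subtype y.2))
    exact (surjective_of_injective a hδ).subsingleton

lemma bijective_map_mkQ_torsion (i : ℕ) :
    Function.Bijective (map a (i + 1) (torsion a A).mkQ) := by
  have ht : ∀ x, x ∈ torsion a (torsion a A) :=
    fun x => mem_torsion_of_map a (torsion a A).injective_subtype x.2
  have h0 := subsingleton_of_torsion a i (torsion a A) ht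
  have h1 := subsingleton_of_torsion a (i + 1) (torsion a A) ht
  have hex : Function.Exact (torsion a A).subtype (torsion a A).mkQ :=
    LinearMap.exact_subtype_mkQ _
  have he := exact_map a (i + 1) (torsion a A).injective_subtype (torsion a A).mkQ_surjective hex
  obtain ⟨δ, hδ, -⟩ := exists_connecting a (i + 1) (torsion a A).injective_subtype
    (torsion a A).mkQ_surjective hex
  constructor
  · rw [injective_iff_map_eq_zero]
    intro x hx
    obtain ⟨y, rfl⟩ := (he x).1 hx
    rw [Subsingleton.elim y 0, _root_.map_zero]
  · intro x
    exact (hδ x).1 (Subsingleton.elim _ _)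

lemma torsion_quotient (x : A ⧸ torsion a A) (hx : x ∈ torsion a (A ⧸ torsion a A)) : x = 0 := by
  obtain ⟨y, rfl⟩ := (torsion a A).mkQ_surjective x
  obtain ⟨k, hk⟩ := hx
  have hfg : ((a ^ k) • Submodule.span R {y}).FG :=
    Submodule.FG.smul (IsNoetherian.noetherian _) (Submodule.fg_span_singleton y)
  have hle : (a ^ k) • Submodule.span R {y} ≤ torsion a A := by
    rw [Submodule.smul_le]
    intro r hr z hz
    obtain ⟨s, rfl⟩ := Submodule.mem_span_singleton.1 hz
    rw [smul_comm]
    apply Submodule.smul_mem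
    have := hk r hr
    rwa [← _root_.map_smul, Submodule.mkQ_apply, Submodule.Quotient.mk_eq_zero] at this
  obtain ⟨l, hl⟩ := exists_pow_smul_eq_zero a hfg hle
  rw [Submodule.mkQ_apply, Submodule.Quotient.mk_eq_zero]
  refine ⟨l + k, fun r hr => ?_⟩
  rw [pow_add] at hr
  induction hr using Submodule.mul_induction_on' with
  | mem_mul_mem r hr s hs =>
    rw [mul_smul]
    exact hl r hr _ (Submodule.smul_mem_smul hs (Submodule.mem_span_singleton_self y))
  | add r _ s _ h1 h2 => rw [add_smul, h1, h2, add_zero]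

end General

end LocCoh

namespace LocCoh

section Localization

variable {R : Type} [CommRing R] (a : Ideal R) (S : Submonoid R)
  {A B : Type} [AddCommGroup A] [Module R A] [AddCommGroup B] [Module R B]

/-- The extension of an ideal to a localization. -/
abbrev locIdeal : Ideal (Localization S) := a.map (algebraMap R (Localization S))

lemma localizedModule_mk_eq_zero_iff {x : A} {s : S} :
    LocalizedModule.mk x s = 0 ↔ ∃ u : S, (u : R) • x = 0 := by
  rw [← LocalizedModule.zero_mk 1, LocalizedModule.mk_eq]
  simp only [one_smul, smul_zero, Submonoid.smul_def]

lemma algebraMap_mem_pow {r : R} {k : ℕ} (hr : r ∈ a ^ k) :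
    algebraMap R (Localization S) r ∈ locIdeal a S ^ k := by
  rw [← Ideal.map_pow]
  exact Ideal.mem_map_of_mem _ hr

lemma mk_mem_torsion {x : A} (hx : x ∈ torsion a A) (s : S) :
    LocalizedModule.mk x s ∈ torsion (locIdeal a S) (LocalizedModule S A) := by
  obtain ⟨k, hk⟩ := hx
  refine ⟨k, fun r hr => ?_⟩
  rw [← Ideal.map_pow] at hr
  have : locIdeal (a ^ k) S ≤ LinearMap.ker
      (LinearMap.toSpanSingleton (Localization S) _ (LocalizedModule.mk x s)) := by
    rw [Ideal.map_le_iff_le_comap]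
    intro t ht
    change algebraMap R (Localization S) t • LocalizedModule.mk x s = 0
    rw [algebraMap_smul, LocalizedModule.smul'_mk, hk t ht, LocalizedModule.zero_mk]
  exact this hr

lemma exists_smul_mem_torsion [IsNoetherianRing R] {x : A} {s : S}
    (h : LocalizedModule.mk x s ∈ torsion (locIdeal a S) (LocalizedModule S A)) :
    ∃ u : S, (u : R) • x ∈ torsion a A := by
  obtain ⟨k, hk⟩ := h
  have key : ∀ r ∈ a ^ k, ∃ u : S, (u : R) • r • x = 0 := by
    intro r hr
    have := hk _ (algebraMap_mem_pow a S hr)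
    rw [algebraMap_smul, LocalizedModule.smul'_mk, localizedModule_mk_eq_zero_iff] at this
    exact this
  have key2 : ∀ I : Ideal R, I.FG → (∀ r ∈ I, ∃ u : S, (u : R) • r • x = 0) →
      ∃ u : S, ∀ r ∈ I, (u : R) • r • x = 0 := by
    intro I hI
    induction I, hI using Submodule.fg_induction with
    | singleton y =>
      intro h
      obtain ⟨u, hu⟩ := h y (Submodule.mem_span_singleton_self y)
      refine ⟨u, fun r hr => ?_⟩
      obtain ⟨t, rfl⟩ := Submodule.mem_span_singleton.1 hr
      rw [smul_assoc, smul_comm, hu, smul_zero]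
    | sup I J _ _ h1 h2 =>
      intro h
      obtain ⟨u, hu⟩ := h1 fun r hr => h r (Ideal.mem_sup_left hr)
      obtain ⟨v, hv⟩ := h2 fun r hr => h r (Ideal.mem_sup_right hr)
      refine ⟨u * v, fun r hr => ?_⟩
      obtain ⟨y, hy, z, hz, rfl⟩ := Submodule.mem_sup.1 hr
      have e1 := hu y hy
      have e2 := hv z hz
      rw [Submonoid.coe_mul, add_smul, smul_add, mul_smul, smul_comm (u : R) (v : R), e1,
        smul_zero, mul_smul, e2, smul_zero, add_zero]
  obtain ⟨u, hu⟩ := key2 _ (IsNoetherian.noetherian (a ^ k)) key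
  exact ⟨u, k, fun r hr => by rw [smul_comm, hu r hr]⟩

variable [IsNoetherianRing R]

lemma injective_localizedModule [Module.Injective R A] :
    Module.Injective (Localization S) (LocalizedModule S A) :=
  Module.injective_of_isLocalizedModule S (LocalizedModule.mkLinearMap S A)

lemma exists_smul_eq_zero_of_localized (i : ℕ) (A : Type) [AddCommGroup A] [Module R A] (k : ℕ)
    (hk : ∀ r ∈ locIdeal a S ^ k,
      ∀ x : locCoh (Localization S) (locIdeal a S) i (LocalizedModule S A), r • x = 0)
    {r : R} (hr : r ∈ a ^ k) (x : locCoh R a i A) : ∃ s : S, (s : R) • r • x = 0 := by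
  induction i generalizing A with
  | zero =>
    have hx : zeroIncl a A x ∈ torsion a A := zeroIncl_mem_torsion a x
    have hx' := mk_mem_torsion a S hx 1
    rw [← range_zeroIncl] at hx'
    obtain ⟨y, hy⟩ := hx'
    have h0 := congrArg (zeroIncl (locIdeal a S) (LocalizedModule S A))
      (hk _ (algebraMap_mem_pow a S hr) y)
    rw [map_smul, hy, _root_.map_zero, algebraMap_smul, LocalizedModule.smul'_mk,
      localizedModule_mk_eq_zero_iff] at h0
    obtain ⟨u, hu⟩ := h0
    refine ⟨u, zeroIncl_injective a ?_⟩
    rw [map_smul, map_smul, _root_.map_zero]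
    exact hu
  | succ i ih =>
    obtain ⟨E, _, _, f, hE, hf⟩ := exists_injective R A
    have hg := f.range.mkQ_surjective
    have hex := LinearMap.exact_map_mkQ_range f
    set g := f.range.mkQ
    obtain ⟨δ, hδ₁, hδ₂⟩ := exists_connecting a i hf hg hex
    obtain ⟨c, rfl⟩ := surjective_of_injective a hδ₂ x
    have hE' := injective_localizedModule S (A := E)
    obtain ⟨δ', hδ₁', hδ₂'⟩ := exists_connecting (locIdeal a S) i
      (f := LocalizedModule.map S f) (g := LocalizedModule.map S g)
      (IsLocalizedModule.map_injective S (LocalizedModule.mkLinearMap S _)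
        (LocalizedModule.mkLinearMap S _) f hf)
      (IsLocalizedModule.map_surjective S (LocalizedModule.mkLinearMap S _)
        (LocalizedModule.mkLinearMap S _) g hg)
      (LocalizedModule.map_exact S f g hex)
    cases i with
    | zero =>
      have hc : zeroIncl a _ c ∈ torsion a (E ⧸ f.range) := zeroIncl_mem_torsion a c
      have hc' := mk_mem_torsion a S hc 1
      rw [← range_zeroIncl] at hc'
      obtain ⟨y, hy⟩ := hc'
      have h0 : δ' (algebraMap R (Localization S) r • y) = 0 := by
        rw [map_smul]
        exact hk _ (algebraMap_mem_pow a S hr) _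
      obtain ⟨e, he⟩ := (hδ₁' _).1 h0
      have he' := congrArg (zeroIncl (locIdeal a S) _) he
      rw [zeroIncl_map, map_smul, hy, algebraMap_smul, LocalizedModule.smul'_mk] at he'
      have het : zeroIncl (locIdeal a S) _ e ∈
          torsion (locIdeal a S) (LocalizedModule S E) := zeroIncl_mem_torsion _ e
      generalize zeroIncl (locIdeal a S) _ e = e' at he' het
      induction e' using LocalizedModule.induction_on with
      | _ z s =>
      obtain ⟨u, hu⟩ := exists_smul_mem_torsion a S het
      rw [LocalizedModule.map_mk, LocalizedModule.mk_eq] at he'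
      obtain ⟨v, hv⟩ := he'
      rw [one_smul] at hv
      have hvt := (torsion a E).smul_mem (v : R) hu
      rw [← range_zeroIncl] at hvt
      obtain ⟨w, hw⟩ := hvt
      refine ⟨u * (v * s), ?_⟩
      rw [← map_smul, ← map_smul]
      refine (hδ₁ _).2 ⟨w, zeroIncl_injective a ?_⟩
      rw [zeroIncl_map, hw, map_smul, map_smul, map_smul, map_smul]
      simp only [Submonoid.smul_def] at hv
      rw [Submonoid.coe_mul, Submonoid.coe_mul, mul_smul, mul_smul, ← hv, smul_comm]
    | succ i =>
      have hinj : Function.Injective δ' := by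
        rw [injective_iff_map_eq_zero]
        intro y hy
        obtain ⟨z, rfl⟩ := (hδ₁' y).1 hy
        have := subsingleton_of_injective (locIdeal a S) i (A := LocalizedModule S E)
        rw [Subsingleton.elim z 0, _root_.map_zero]
      obtain ⟨s, hs⟩ := ih (E ⧸ f.range) (fun r hr x => hinj (by
        rw [map_smul, _root_.map_zero]
        exact hk r hr _)) c
      refine ⟨s, ?_⟩
      rw [← map_smul, ← map_smul, hs, _root_.map_zero]

end Localization

end LocCoh

namespace LocCoh

section Serre

variable {R : Type} [CommRing R] (S : Set (Ideal R)) (a : Ideal R)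
  {X Y Z : Type} [AddCommGroup X] [Module R X] [AddCommGroup Y] [Module R Y]
  [AddCommGroup Z] [Module R Z]

/-- Every element of `X` lies in `N` locally at every ideal of `S`. -/
def LocallyMem (N : Submodule R X) : Prop :=
  ∀ p ∈ S, ∀ x : X, ∃ s ∉ p, s • x ∈ N

/-- `X` agrees with one of its finitely generated submodules locally at every ideal of `S`. -/
def FGOn (X : Type) [AddCommGroup X] [Module R X] : Prop :=
  ∃ N : Submodule R X, N.FG ∧ LocallyMem S N

/-- Some power of `a` annihilates `X` locally at every ideal of `S`. -/
def KilledOn (X : Type) [AddCommGroup X] [Module R X] : Prop :=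
  ∃ k : ℕ, ∀ r ∈ a ^ k, ∀ p ∈ S, ∀ x : X, ∃ s ∉ p, s • r • x = 0

variable {S a}

lemma FGOn.of_fg [Module.Finite R X] (hS : ∀ p ∈ S, p.IsPrime) : FGOn S X :=
  ⟨⊤, Module.Finite.fg_top, fun p hp _ => ⟨1, (Ideal.ne_top_iff_one p).1 (hS p hp).ne_top,
    trivial⟩⟩

lemma FGOn.of_subsingleton [Subsingleton X] (hS : ∀ p ∈ S, p.IsPrime) : FGOn S X :=
  FGOn.of_fg hS

lemma exists_fg_map_eq {g : Y →ₗ[R] Z} {N : Submodule R Z} (hN : N.FG)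
    (h : N ≤ LinearMap.range g) : ∃ L : Submodule R Y, L.FG ∧ L.map g = N := by
  obtain ⟨T, hT, rfl⟩ := Submodule.fg_def.1 hN
  refine ⟨Submodule.span R (Function.invFun g '' T), Submodule.fg_span (hT.image _), ?_⟩
  rw [Submodule.map_span, Set.image_image]
  congr 1
  have : ∀ z ∈ T, g (Function.invFun g z) = id z := fun z hz =>
    Function.invFun_eq (h (Submodule.subset_span hz))
  rw [Set.image_congr this, Set.image_id]

lemma FGOn.of_exact [IsNoetherianRing R] (hS : ∀ p ∈ S, p.IsPrime) {f : X →ₗ[R] Y}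
    {g : Y →ₗ[R] Z} (h : Function.Exact f g) (hX : FGOn S X) (hZ : FGOn S Z) : FGOn S Y := by
  obtain ⟨N, hN, hN'⟩ := hX
  obtain ⟨P, hP, hP'⟩ := hZ
  have : (P ⊓ LinearMap.range g).FG := by
    have := isNoetherian_of_fg_of_noetherian P hP
    exact Submodule.FG.of_le hP inf_le_left
  obtain ⟨L, hL, hL'⟩ : ∃ L : Submodule R Y, L.FG ∧ L.map g = P ⊓ LinearMap.range g :=
    exists_fg_map_eq this inf_le_right
  refine ⟨N.map f ⊔ L, (hN.map f).sup hL, fun p hp y => ?_⟩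
  obtain ⟨s, hs, hs'⟩ := hP' p hp (g y)
  obtain ⟨l, hl, hl'⟩ : s • g y ∈ L.map g := by
    rw [hL']
    exact ⟨hs', s • y, by rw [_root_.map_smul]⟩
  obtain ⟨x, hx⟩ := (h (s • y - l)).1 (by rw [map_sub, _root_.map_smul, hl', sub_self])
  obtain ⟨t, ht, ht'⟩ := hN' p hp x
  refine ⟨t * s, fun hm => ((hS p hp).mem_or_mem hm).elim ht hs, ?_⟩
  have : (t * s) • y = f (t • x) + t • l := by
    rw [_root_.map_smul, hx, smul_sub, mul_smul, sub_add_cancel]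
  rw [this]
  exact Submodule.add_mem_sup (Submodule.mem_map_of_mem ht') (L.smul_mem t hl)

lemma KilledOn.of_exact (hS : ∀ p ∈ S, p.IsPrime) {f : X →ₗ[R] Y}
    {g : Y →ₗ[R] Z} (h : Function.Exact f g) (hX : KilledOn S a X) (hZ : KilledOn S a Z) :
    KilledOn S a Y := by
  obtain ⟨k, hk⟩ := hX
  obtain ⟨l, hl⟩ := hZ
  refine ⟨k + l, fun r hr p hp y => ?_⟩
  rw [pow_add] at hr
  induction hr using Submodule.mul_induction_on' with
  | mem_mul_mem r hr t ht =>
    obtain ⟨s, hs, hs'⟩ := hl t ht p hp (g y)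
    obtain ⟨x, hx⟩ := (h (s • t • y)).1 (by rw [_root_.map_smul, _root_.map_smul, hs'])
    obtain ⟨u, hu, hu'⟩ := hk r hr p hp x
    refine ⟨u * s, fun hm => ((hS p hp).mem_or_mem hm).elim hu hs, ?_⟩
    have : (u * s) • (r * t) • y = f (u • r • x) := by
      rw [_root_.map_smul, _root_.map_smul, hx]
      simp only [smul_smul]
      congr 1
      ring
    rw [this, hu', _root_.map_zero]
  | add r _ t _ h1 h2 =>
    obtain ⟨s, hs, hs'⟩ := h1
    obtain ⟨u, hu, hu'⟩ := h2
    refine ⟨s * u, fun hm => ((hS p hp).mem_or_mem hm).elim hs hu, ?_⟩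
    rw [add_smul, smul_add, mul_smul, mul_smul, hu', smul_comm, hs', smul_zero, smul_zero,
      add_zero]

variable [IsNoetherianRing R]

lemma finite_associatedPrimes_of_finite [Module.Finite R X] (N : Submodule R X) :
    N.associatedPrimes.Finite := by
  refine (associatedPrimes.finite R (X ⧸ N)).subset fun p hp => ?_
  obtain ⟨hp, x, hx⟩ := Submodule.isAssociatedPrime_iff.1 hp
  refine isAssociatedPrime_iff.2 ⟨hp, N.mkQ x, ?_⟩
  ext r
  rw [hx, Submodule.mem_colon_singleton, Submodule.mem_colon_singleton, Submodule.mem_bot,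
    ← _root_.map_smul, Submodule.mkQ_apply, Submodule.Quotient.mk_eq_zero]

/-- An associated prime of `N` in `S` is an associated prime of any submodule of `N` agreeing with
`N` locally on `S`. -/
lemma mem_associatedPrimes_of_le {N N' : Submodule R X} (hle : N' ≤ N)
    (h : ∀ p ∈ S, ∀ x ∈ N, ∃ s ∉ p, s • x ∈ N') {p : Ideal R} (hpS : p ∈ S)
    (hp : p ∈ N.associatedPrimes) : p ∈ N'.associatedPrimes := by
  obtain ⟨hp, x, hx⟩ := Submodule.isAssociatedPrime_iff.1 hp
  have key : ∀ I : Ideal R, I.FG → I ≤ p → ∃ s ∉ p, ∀ r ∈ I, s • r • x ∈ N' := by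
    intro I hI
    induction I, hI using Submodule.fg_induction with
    | singleton y =>
      intro hy
      obtain ⟨s, hs, hs'⟩ := h p hpS (y • x) (by
        rw [← Submodule.mem_colon_singleton, ← hx]
        exact hy (Submodule.mem_span_singleton_self y))
      refine ⟨s, hs, fun r hr => ?_⟩
      obtain ⟨t, rfl⟩ := Submodule.mem_span_singleton.1 hr
      rw [smul_assoc, smul_comm]
      exact N'.smul_mem t hs'
    | sup I J _ _ h1 h2 =>
      intro hIJ
      obtain ⟨s, hs, hs'⟩ := h1 (le_sup_left.trans hIJ)
      obtain ⟨t, ht, ht'⟩ := h2 (le_sup_right.trans hIJ)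
      refine ⟨s * t, fun hm => (hp.mem_or_mem hm).elim hs ht, fun r hr => ?_⟩
      obtain ⟨y, hy, z, hz, rfl⟩ := Submodule.mem_sup.1 hr
      have : (s * t) • (y + z) • x = t • s • y • x + s • t • z • x := by
        simp only [smul_smul, ← add_smul]
        congr 1
        ring
      rw [this]
      exact N'.add_mem (N'.smul_mem t (hs' y hy)) (N'.smul_mem s (ht' z hz))
  obtain ⟨s, hs, hs'⟩ := key p (IsNoetherian.noetherian p) le_rfl
  refine Submodule.isAssociatedPrime_iff.2 ⟨hp, s • x, ?_⟩
  ext r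
  rw [Submodule.mem_colon_singleton]
  refine ⟨fun hr => by rw [smul_comm]; exact hs' r hr, fun hr => ?_⟩
  have : r * s ∈ p := by
    rw [hx, Submodule.mem_colon_singleton, mul_smul]
    exact hle hr
  exact (hp.mem_or_mem this).resolve_right hs

lemma exists_associatedPrime_le {x : X} {p : Ideal R} (hp : p.IsPrime)
    (h : ∀ s ∉ p, s • x ≠ 0) :
    ∃ q ∈ associatedPrimes R X, q ≤ p ∧ ∀ s : R, s • x = 0 → s ∈ q := by
  have hle : (⊥ : Submodule R X).colon {x} ≤ p := by
    intro s hs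
    by_contra hsp
    exact h s hsp (by simpa using hs)
  obtain ⟨q, hq, hqp⟩ := Ideal.exists_minimalPrimes_le hle
  have hq' := hq.1.1
  refine ⟨q, ?_, hqp, fun s hs => hq.1.2 (by simpa using hs)⟩
  obtain ⟨y, hy⟩ := Submodule.exists_eq_colon_of_mem_minimalPrimes hq
  exact isAssociatedPrime_iff.2 ⟨hq', y, hy⟩

lemma exists_mem_injective_lsmul [Module.Finite R X] (h : ∀ x ∈ torsion a X, x = 0) :
    ∃ r ∈ a, Function.Injective (LinearMap.lsmul R X r) := by
  by_contra! hcon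
  have hsub : (a : Set R) ⊆ ⋃ p ∈ associatedPrimes R X, (p : Set R) := by
    intro r hr
    rw [biUnion_associatedPrimes_eq_zero_divisors]
    have := hcon r hr
    rw [injective_iff_map_eq_zero] at this
    push Not at this
    obtain ⟨x, hx, hx0⟩ := this
    exact ⟨x, hx0, hx⟩
  obtain ⟨p, hp, hap⟩ := (Ideal.subset_union_prime_finite (associatedPrimes.finite R X) ⊥ ⊥
    (fun p hp _ _ => hp.isPrime)).1 hsub
  obtain ⟨hp, x, hx⟩ := isAssociatedPrime_iff.1 hp
  have hx0 : x = 0 := h x ⟨1, fun r hr => by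
    rw [pow_one] at hr
    have := hap hr
    rw [hx] at this
    simpa using this⟩
  apply hp.ne_top
  rw [hx, hx0]
  ext
  simp

end Serre

end LocCoh

namespace LocCoh

section Finiteness

variable {R : Type} [CommRing R] {S : Set (Ideal R)} {a : Ideal R}
  {X Y Z : Type} [AddCommGroup X] [Module R X] [AddCommGroup Y] [Module R Y]
  [AddCommGroup Z] [Module R Z]

lemma KilledOn.of_surjective (hS : ∀ p ∈ S, p.IsPrime) {f : X →ₗ[R] Y}
    (hf : Function.Surjective f) (h : KilledOn S a X) : KilledOn S a Y :=
  h.of_exact hS ((LinearMap.exact_zero_iff_surjective PUnit.{1} f).2 hf)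
    ⟨0, fun _ _ p hp _ => ⟨1, (Ideal.ne_top_iff_one p).1 (hS p hp).ne_top, rfl⟩⟩

variable (a) in
/-- The long exact sequence of multiplication by an element `y` acting injectively on `X`. -/
lemma exists_connecting_smul {y : R} (hy : Function.Injective (LinearMap.lsmul R X y)) (i : ℕ) :
    ∃ δ : locCoh R a i (X ⧸ LinearMap.range (LinearMap.lsmul R X y)) →ₗ[R] locCoh R a (i + 1) X,
      Function.Exact (map a i (LinearMap.range (LinearMap.lsmul R X y)).mkQ) δ ∧
      Function.Exact δ (LinearMap.lsmul R (locCoh R a (i + 1) X) y) := by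
  obtain ⟨δ, h1, h2⟩ := exists_connecting a i hy (Submodule.mkQ_surjective _)
    (LinearMap.exact_map_mkQ_range (LinearMap.lsmul R X y))
  refine ⟨δ, h1, ?_⟩
  have : map a (i + 1) (LinearMap.lsmul R X y) = LinearMap.lsmul R (locCoh R a (i + 1) X) y :=
    map_smul_id a (i + 1) y
  rwa [← this]

/-- A power of an element acting injectively acts injectively. -/
lemma injective_lsmul_pow {y : R} (hy : Function.Injective (LinearMap.lsmul R X y)) (k : ℕ) :
    Function.Injective (LinearMap.lsmul R X (y ^ k)) := by
  induction k with
  | zero => intro u v h; simpa using h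
  | succ k ih =>
    intro u v h
    apply hy
    apply ih
    simpa only [pow_succ, LinearMap.lsmul_apply, mul_smul] using h

variable [IsNoetherianRing R]

lemma FGOn.of_surjective (hS : ∀ p ∈ S, p.IsPrime) {f : X →ₗ[R] Y}
    (hf : Function.Surjective f) (h : FGOn S X) : FGOn S Y :=
  h.of_exact hS ((LinearMap.exact_zero_iff_surjective PUnit.{1} f).2 hf) (.of_subsingleton hS)

lemma FGOn.of_injective (hS : ∀ p ∈ S, p.IsPrime) {f : X →ₗ[R] Y}
    (hf : Function.Injective f) (h : FGOn S Y) : FGOn S X :=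
  FGOn.of_exact hS ((LinearMap.exact_zero_iff_injective PUnit.{1} f).2 hf)
    (.of_subsingleton hS) h

variable (a)

lemma surjective_map_mkQ_torsion (j : ℕ) :
    Function.Surjective (map a j (torsion a X).mkQ) := by
  cases j with
  | zero =>
    intro x
    have hx : zeroIncl a _ x ∈ torsion a (X ⧸ torsion a X) := zeroIncl_mem_torsion a x
    have : x = 0 := zeroIncl_injective a ((torsion_quotient a _ hx).trans (_root_.map_zero _).symm)
    exact ⟨0, by rw [this, _root_.map_zero]⟩
  | succ j => exact (bijective_map_mkQ_torsion a j).2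

instance finite_locCoh_zero [Module.Finite R X] : Module.Finite R (locCoh R a 0 X) :=
  Module.Finite.of_injective (zeroIncl a X) (zeroIncl_injective a)

variable {a}

lemma finite_associatedPrimes_locCoh (hS : ∀ p ∈ S, p.IsPrime) (i : ℕ)
    (M : Type) [AddCommGroup M] [Module R M] [Module.Finite R M]
    (hM : ∀ j < i, FGOn S (locCoh R a j M)) (N : Submodule R (locCoh R a i M)) (hN : N.FG) :
    {p ∈ N.associatedPrimes | p ∈ S}.Finite := by
  induction i generalizing M with
  | zero => exact (finite_associatedPrimes_of_finite N).subset fun p hp => hp.1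
  | succ i ih =>
    have core : ∀ (M : Type) [AddCommGroup M] [Module R M] [Module.Finite R M]
        (_ : ∀ j < i + 1, FGOn S (locCoh R a j M)) (N : Submodule R (locCoh R a (i + 1) M))
        (_ : N.FG) (_ : ∀ x ∈ torsion a M, x = 0),
        {p ∈ N.associatedPrimes | p ∈ S}.Finite := by
      intro M _ _ _ hM N hN htor
      obtain ⟨r, hra, hr⟩ := exists_mem_injective_lsmul htor
      obtain ⟨k, hk⟩ := exists_pow_smul_eq_zero a hN fun x _ => mem_torsion_locCoh a _ M x
      have hy := injective_lsmul_pow hr (k + 1)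
      have hkN : ∀ x ∈ N, r ^ k • x = 0 := hk _ (Ideal.pow_mem_pow hra k)
      obtain ⟨δ, h1, h2⟩ := exists_connecting_smul a hy i
      have hC : ∀ j < i, FGOn S
          (locCoh R a j (M ⧸ LinearMap.range (LinearMap.lsmul R M (r ^ (k + 1))))) := by
        intro j hj
        obtain ⟨δ', h1', -⟩ := exists_connecting_smul a hy j
        exact (hM j (by omega)).of_exact hS h1' (hM (j + 1) (by omega))
      have hN' : FGOn S (N.comap δ) := by
        have hle : ∀ x, map a i (LinearMap.range (LinearMap.lsmul R M (r ^ (k + 1)))).mkQ x ∈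
            N.comap δ := fun x => by
          rw [Submodule.mem_comap, h1.apply_apply_eq_zero]
          exact N.zero_mem
        have hex : Function.Exact
            ((map a i (LinearMap.range (LinearMap.lsmul R M (r ^ (k + 1)))).mkQ).codRestrict _ hle)
            (δ.restrict (p := N.comap δ) (q := N) fun x hx => hx) := by
          intro x
          constructor
          · intro hx
            obtain ⟨z, hz⟩ := (h1 x).1 (congrArg Subtype.val hx)
            exact ⟨z, Subtype.ext hz⟩
          · rintro ⟨z, rfl⟩
            exact Subtype.ext (h1.apply_apply_eq_zero z)
        have : Module.Finite R N := Module.Finite.of_fg hN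
        exact (hM i (by omega)).of_exact hS hex (.of_fg hS)
      obtain ⟨L, hL, hL'⟩ := hN'
      refine (ih _ hC (L.map (N.comap δ).subtype) (hL.map _)).subset ?_
      rintro p ⟨hp, hpS⟩
      refine ⟨mem_associatedPrimes_of_le (N := N.comap δ) (S := S) (Submodule.map_subtype_le _ _)
        ?_ hpS ?_, hpS⟩
      · intro q hq x hx
        obtain ⟨s, hs, hs'⟩ := hL' q hq ⟨x, hx⟩
        exact ⟨s, hs, _, hs', rfl⟩
      · obtain ⟨hp, x, hx⟩ := Submodule.isAssociatedPrime_iff.1 hp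
        have hrp : r ∈ p := by
          obtain ⟨l, hl⟩ := mem_torsion_locCoh a _ M x
          refine hp.mem_of_pow_mem l ?_
          rw [hx, Submodule.mem_colon_singleton, hl _ (Ideal.pow_mem_pow hra l)]
          exact N.zero_mem
        obtain ⟨z, rfl⟩ := (h2 x).1 (by
          rw [LinearMap.lsmul_apply, pow_succ, mul_smul]
          apply hkN
          rwa [← Submodule.mem_colon_singleton, ← hx])
        refine Submodule.isAssociatedPrime_iff.2 ⟨hp, z, ?_⟩
        ext s
        rw [hx, Submodule.mem_colon_singleton, Submodule.mem_colon_singleton,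
          Submodule.mem_comap, _root_.map_smul]
    have hb := bijective_map_mkQ_torsion (A := M) a i
    refine (core (M ⧸ torsion a M)
      (fun j hj => (hM j hj).of_surjective hS (surjective_map_mkQ_torsion a j))
      (N.map (map a (i + 1) (torsion a M).mkQ)) (hN.map _)
      (fun x hx => torsion_quotient a x hx)).subset ?_
    rintro p ⟨hp, hpS⟩
    refine ⟨?_, hpS⟩
    obtain ⟨hp, x, hx⟩ := Submodule.isAssociatedPrime_iff.1 hp
    refine Submodule.isAssociatedPrime_iff.2 ⟨hp, map a (i + 1) (torsion a M).mkQ x, ?_⟩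
    ext s
    rw [hx, Submodule.mem_colon_singleton, Submodule.mem_colon_singleton, ← _root_.map_smul]
    refine ⟨fun h => Submodule.mem_map_of_mem h, ?_⟩
    rintro ⟨z, hz, hzs⟩
    rwa [← hb.1 hzs]

lemma fgOn_locCoh (hS : ∀ p ∈ S, p.IsPrime) (i : ℕ)
    (M : Type) [AddCommGroup M] [Module R M] [Module.Finite R M]
    (hM : ∀ j ≤ i, KilledOn S a (locCoh R a j M)) : FGOn S (locCoh R a i M) := by
  induction i generalizing M with
  | zero => exact .of_fg hS
  | succ i ih =>
    have core : ∀ (M : Type) [AddCommGroup M] [Module R M] [Module.Finite R M]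
        (_ : ∀ j ≤ i + 1, KilledOn S a (locCoh R a j M)) (_ : ∀ x ∈ torsion a M, x = 0),
        FGOn S (locCoh R a (i + 1) M) := by
      intro M _ _ _ hM htor
      obtain ⟨r, hra, hr⟩ := exists_mem_injective_lsmul htor
      obtain ⟨k, hk⟩ := hM (i + 1) le_rfl
      have hy := injective_lsmul_pow hr k
      obtain ⟨δ, -, h2⟩ := exists_connecting_smul a hy i
      have hC := ih (M ⧸ LinearMap.range (LinearMap.lsmul R M (r ^ k))) fun j hj => by
        obtain ⟨δ', h1', -⟩ := exists_connecting_smul a hy j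
        exact (hM j (by omega)).of_exact hS h1' (hM (j + 1) (by omega))
      refine hC.of_exact hS (f := δ) (g := (LinearMap.lsmul R _ (r ^ k)).rangeRestrict) ?_
        ⟨⊥, Submodule.fg_bot, fun p hp x => ?_⟩
      · intro x
        rw [← h2 x]
        exact Subtype.ext_iff
      · obtain ⟨_, z, rfl⟩ := x
        obtain ⟨s, hs, hs'⟩ := hk _ (Ideal.pow_mem_pow hra k) p hp z
        exact ⟨s, hs, Subtype.ext hs'⟩
    exact (core (M ⧸ torsion a M)
      (fun j hj => (hM j hj).of_surjective hS (surjective_map_mkQ_torsion a j))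
      (fun x hx => torsion_quotient a x hx)).of_injective hS (bijective_map_mkQ_torsion a i).1

lemma KilledOn.of_forall (hS : ∀ p ∈ S, p.IsPrime)
    (hS' : ∀ p ∈ S, ∀ q : Ideal R, q.IsPrime → q ≤ p → q ∈ S)
    (hfin : {p ∈ associatedPrimes R X | p ∈ S}.Finite)
    (h : ∀ p ∈ S, ∃ k : ℕ, ∀ r ∈ a ^ k, ∀ x : X, ∃ s ∉ p, s • r • x = 0) : KilledOn S a X := by
  choose! k hk using h
  obtain ⟨n, hn⟩ := (hfin.image k).bddAbove
  refine ⟨n, fun r hr p hp x => ?_⟩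
  by_contra! hcon
  obtain ⟨q, hq, hqp, hq'⟩ := exists_associatedPrime_le (hS p hp) hcon
  have hqS := hS' p hp q hq.isPrime hqp
  have hle : k q ≤ n := hn ⟨q, ⟨hq, hqS⟩, rfl⟩
  obtain ⟨s, hs, hs'⟩ := hk q hqS r (Ideal.pow_le_pow_right hle hr) x
  exact absurd (hq' s hs') hs

/-- If `H^i_a(M)` is, locally at each prime of `S`, annihilated by a power of `a` for all `i < t`,
then `H^t_a(M)` has only finitely many associated primes in `S`, and so do the lower ones. -/
lemma finite_associatedPrimes_locCoh_of_forall (hS : ∀ p ∈ S, p.IsPrime)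
    (hS' : ∀ p ∈ S, ∀ q : Ideal R, q.IsPrime → q ≤ p → q ∈ S) (t : ℕ)
    (M : Type) [AddCommGroup M] [Module R M] [Module.Finite R M]
    (h : ∀ i < t, ∀ p ∈ S, ∃ k : ℕ, ∀ r ∈ a ^ k, ∀ x : locCoh R a i M, ∃ s ∉ p, s • r • x = 0)
    {i : ℕ} (hi : i ≤ t) : {p ∈ associatedPrimes R (locCoh R a i M) | p ∈ S}.Finite := by
  have key : ∀ i < t, KilledOn S a (locCoh R a i M) := by
    intro i
    induction i using Nat.strong_induction_on with
    | _ i ih =>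
      intro hi
      refine .of_forall hS hS' ?_ (h i hi)
      exact finite_associatedPrimes_locCoh hS i M
        (fun j hj => fgOn_locCoh hS j M fun l hl => ih l (by omega) (by omega)) ⊥ Submodule.fg_bot
  exact finite_associatedPrimes_locCoh hS i M
    (fun j hj => fgOn_locCoh hS j M fun l hl => key l (by omega)) ⊥ Submodule.fg_bot

end Finiteness

section Local

variable {R : Type} [CommRing R] (a : Ideal R)
  (M : Type) [AddCommGroup M] [Module R M]

/-- Below the finiteness dimension, local cohomology is annihilated by a power of the ideal. -/
lemma exists_pow_smul_eq_zero_of_lt_finDim {i : ℕ} (hi : (i : ℕ∞) < finDim R a M) :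
    ∃ k : ℕ, ∀ r ∈ a ^ k, ∀ x : locCoh R a i M, r • x = 0 := by
  have hfin : Module.Finite R (locCoh R a i M) := by
    by_contra hcon
    exact absurd (sInf_le (Set.mem_image_of_mem _ hcon)) (not_le.2 hi)
  obtain ⟨k, hk⟩ := exists_pow_smul_eq_zero a (N := (⊤ : Submodule R (locCoh R a i M)))
    Module.Finite.fg_top fun x _ => mem_torsion_locCoh a i M x
  exact ⟨k, fun r hr x => hk r hr x trivial⟩

variable [IsNoetherianRing R] [Module.Finite R M]

lemma exists_pow_smul_smul_eq_zero {i : ℕ} (p : PrimeSpectrum R)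
    (h : p ∈ Module.support R (M ⧸ (a • ⊤ : Submodule R M)) →
      (i : ℕ∞) < finDim (Localization.AtPrime p.asIdeal)
        (a.map (algebraMap R (Localization.AtPrime p.asIdeal)))
        (LocalizedModule p.asIdeal.primeCompl M)) :
    ∃ k : ℕ, ∀ r ∈ a ^ k, ∀ x : locCoh R a i M, ∃ s ∉ p.asIdeal, s • r • x = 0 := by
  by_cases hp : p ∈ Module.support R (M ⧸ (a • ⊤ : Submodule R M))
  · obtain ⟨k, hk⟩ := exists_pow_smul_eq_zero_of_lt_finDim _ _ (h hp)
    refine ⟨k, fun r hr x => ?_⟩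
    obtain ⟨s, hs⟩ := exists_smul_eq_zero_of_localized a p.asIdeal.primeCompl i M k hk hr x
    exact ⟨s, s.2, hs⟩
  · refine ⟨0, fun r _ x => ?_⟩
    by_cases hap : a ≤ p.asIdeal
    · have hpM : p ∉ Module.support R M := by
        intro hM
        apply hp
        rw [Module.support_quotient]
        exact ⟨hM, hap⟩
      rw [Module.mem_support_iff_of_finite] at hpM
      obtain ⟨s, hs, hsp⟩ := SetLike.not_le_iff_exists.1 hpM
      refine ⟨s, hsp, ?_⟩
      have h0 : (s • LinearMap.id : M →ₗ[R] M) = (0 : R) • LinearMap.id := by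
        ext m
        simpa using Module.mem_annihilator.1 hs m
      have := congrArg (map a i) h0
      rw [map_smul_id, map_smul_id, zero_smul] at this
      exact LinearMap.congr_fun this (r • x)
    · obtain ⟨s, hs, hsp⟩ := SetLike.not_le_iff_exists.1 hap
      obtain ⟨k, hk⟩ := mem_torsion_locCoh a i M (r • x)
      exact ⟨s ^ k, fun hm => hsp (p.2.mem_of_pow_mem k hm), hk _ (Ideal.pow_mem_pow hs k)⟩

end Local

lemma associatedPrimes_directSum_subset {R : Type} [CommRing R] [IsNoetherianRing R] {ι : Type}
    [Fintype ι] (X : ι → Type) [∀ i, AddCommGroup (X i)] [∀ i, Module R (X i)] :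
    associatedPrimes R (DirectSum ι X) ⊆ ⋃ i, associatedPrimes R (X i) := by
  classical
  intro p hp
  obtain ⟨hp, x, hx⟩ := isAssociatedPrime_iff.1 hp
  have hinf : Finset.univ.inf (fun i => (⊥ : Submodule R (X i)).colon {x i}) ≤ p := by
    intro r hr
    rw [hx, Submodule.mem_colon_singleton, Submodule.mem_bot]
    refine DFinsupp.ext fun i => ?_
    have := Finset.inf_le (f := fun i => (⊥ : Submodule R (X i)).colon {x i})
      (Finset.mem_univ i) hr
    rwa [Submodule.mem_colon_singleton, Submodule.mem_bot] at this
  obtain ⟨i, -, hi⟩ := (hp.inf_le' ).1 hinf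
  refine Set.mem_iUnion.2 ⟨i, isAssociatedPrime_iff.2 ⟨hp, x i, le_antisymm ?_ hi⟩⟩
  intro r hr
  rw [hx, Submodule.mem_colon_singleton, Submodule.mem_bot] at hr
  rw [Submodule.mem_colon_singleton, Submodule.mem_bot]
  exact DFunLike.congr_fun hr i

end LocCoh

/-- If `f_a^n(M) = t` is finite, then the set of associated primes `p` of
`⊕_{i=0}^{t} H^i_a(M)` with `dim R/p ≥ n` is finite. -/
theorem finite_assPrimes_directSum_locCoh (R : Type) [CommRing R] [IsNoetherianRing R]
    (a : Ideal R) (M : Type) [AddCommGroup M] [Module R M] [Module.Finite R M]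
    (n t : ℕ) (ht : finDimN R a n M = (t : ℕ∞)) :
    {p ∈ associatedPrimes R (⨁ i : Fin (t + 1), ↥(locCoh R a (i : ℕ) M)) |
      (n : WithBot ℕ∞) ≤ ringKrullDim (R ⧸ p)}.Finite := by
  let S : Set (Ideal R) := {p | p.IsPrime ∧ (n : WithBot ℕ∞) ≤ ringKrullDim (R ⧸ p)}
  have hS : ∀ p ∈ S, p.IsPrime := fun p hp => hp.1
  have hS' : ∀ p ∈ S, ∀ q : Ideal R, q.IsPrime → q ≤ p → q ∈ S := fun p hp q hq hqp =>
    ⟨hq, hp.2.trans (ringKrullDim_le_of_surjective (Ideal.Quotient.factor hqp)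
      (Ideal.Quotient.factor_surjective hqp))⟩
  have hloc : ∀ i < t, ∀ p ∈ S, ∃ k : ℕ, ∀ r ∈ a ^ k, ∀ x : locCoh R a i M,
      ∃ s ∉ p, s • r • x = 0 := by
    intro i hi p hp
    refine LocCoh.exists_pow_smul_smul_eq_zero a M ⟨p, hp.1⟩ fun hsupp => ?_
    have hle : (t : ℕ∞) ≤ _ := ht.ge.trans (sInf_le ⟨⟨p, hp.1⟩, hsupp, hp.2, rfl⟩)
    exact (Nat.cast_lt.2 hi).trans_le hle
  refine (Set.finite_iUnion fun i : Fin (t + 1) =>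
    LocCoh.finite_associatedPrimes_locCoh_of_forall hS hS' t M hloc
      (Nat.lt_succ_iff.1 i.2)).subset ?_
  rintro p ⟨hp, hpn⟩
  obtain ⟨i, hi⟩ := Set.mem_iUnion.1
    (LocCoh.associatedPrimes_directSum_subset (fun i : Fin (t + 1) => locCoh R a (i : ℕ) M) hp)
  exact Set.mem_iUnion.2 ⟨i, hi, hp.isPrime, hpn⟩
end
end

section
/- Let R be a commutative Noetherian ring, n a non-negative integer, and L an R-module with dim L ≥ n. If L' is a submodule of L such that dim L/L' ≥ n, then the intersection of all primes in (Ass_R L)_{≥n} is contained in the intersection of all primes in (Ass_R L/L')_{≥n}. -/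
open CategoryTheory

noncomputable section

/-- Over a Noetherian ring, every prime in the support of a module contains an associated prime
of the module. -/
theorem Module.exists_mem_associatedPrimes_le_of_mem_support {R M : Type*} [CommRing R]
    [IsNoetherianRing R] [AddCommGroup M] [Module R M] {p : PrimeSpectrum R}
    (hp : p ∈ Module.support R M) : ∃ q ∈ associatedPrimes R M, q ≤ p.asIdeal := by
  obtain ⟨m, hm⟩ := Module.mem_support_iff_exists_annihilator.mp hp
  obtain ⟨q, hq, hqp⟩ := Ideal.exists_minimalPrimes_le hm
  exact ⟨q, associatedPrimes.subset_of_injective (R ∙ m).injective_subtype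
    (Module.associatedPrimes.minimalPrimes_annihilator_subset_associatedPrimes R (R ∙ m) hq), hqp⟩

/-- An associated prime of a module lies in its support. -/
theorem IsAssociatedPrime.mem_support {R M : Type*} [CommRing R] [IsNoetherianRing R]
    [AddCommGroup M] [Module R M] {p : Ideal R} (hp : IsAssociatedPrime p M) :
    ⟨p, hp.isPrime⟩ ∈ Module.support R M := by
  obtain ⟨-, x, hx⟩ := isAssociatedPrime_iff.mp hp
  refine Module.mem_support_iff_exists_annihilator.mpr ⟨x, fun r hr ↦ ?_⟩
  rw [Submodule.mem_annihilator_span_singleton] at hr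
  simpa [hx, Submodule.mem_colon_singleton] using hr

/-- If `dim L ≥ n` and `L' ⊆ L` is a submodule with `dim L/L' ≥ n`, then the intersection of
the primes in `(Ass_R L)_{≥ n}` is contained in the intersection of the primes in
`(Ass_R L/L')_{≥ n}`. -/
theorem sInf_assPrimes_le_sInf_assPrimes_quotient (R : Type) [CommRing R] [IsNoetherianRing R]
    (n : ℕ) (L : Type) [AddCommGroup L] [Module R L]
    (hL : (n : WithBot ℕ∞) ≤ Order.krullDim (Module.support R L))
    (L' : Submodule R L)
    (hL' : (n : WithBot ℕ∞) ≤ Order.krullDim (Module.support R (L ⧸ L'))) :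
    sInf {p ∈ associatedPrimes R L | (n : WithBot ℕ∞) ≤ ringKrullDim (R ⧸ p)} ≤
      sInf {p ∈ associatedPrimes R (L ⧸ L') | (n : WithBot ℕ∞) ≤ ringKrullDim (R ⧸ p)} := by
  refine le_sInf fun p ⟨hp, hn⟩ ↦ ?_
  obtain ⟨q, hq, hqp⟩ := Module.exists_mem_associatedPrimes_le_of_mem_support
    (Module.support_subset_of_surjective L'.mkQ L'.mkQ_surjective
      (IsAssociatedPrime.mem_support hp))
  have hdim : ringKrullDim (R ⧸ p) ≤ ringKrullDim (R ⧸ q) :=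
    ringKrullDim_le_of_surjective (Ideal.Quotient.factor hqp) (Ideal.Quotient.factor_surjective hqp)
  exact sInf_le_of_le ⟨hq, hn.trans hdim⟩ hqp
end
end

section
/- Let R be a commutative Noetherian ring, n a non-negative integer, and L an R-module that is in dimension < n. Then the set (Ass_R L)_{≥n} = { p ∈ Ass_R L : dim R/p ≥ n } is finite. -/
open CategoryTheory

noncomputable section

/-- If `L` is an `R`-module in dimension `< n`, then the set
`(Ass_R L)_{≥ n} = {p ∈ Ass_R L | dim R/p ≥ n}` is finite. -/
theorem finite_assPrimes_of_inDimLT (R : Type) [CommRing R] [IsNoetherianRing R]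
    (n : ℕ) (L : Type) [AddCommGroup L] [Module R L] (hL : InDimLT R L n) :
    {p ∈ associatedPrimes R L | (n : WithBot ℕ∞) ≤ ringKrullDim (R ⧸ p)}.Finite := by
  obtain ⟨N, hN, hdim⟩ := hL
  have : Module.Finite R N := Module.Finite.iff_fg.mpr hN
  refine (associatedPrimes.finite R N).subset ?_
  rintro p ⟨hp, hpn⟩
  have hunion := associatedPrimes.subset_union_of_exact N.subtype_injective
    (LinearMap.exact_subtype_mkQ N)
  refine (hunion hp).resolve_right fun hq => ?_
  have hle : ringKrullDim (R ⧸ p) ≤ Module.supportDim R (L ⧸ N) := by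
    obtain ⟨_, f, hf⟩ := (isAssociatedPrime_iff_exists_injective_linearMap p (L ⧸ N)).mp hq
    rw [← Module.supportDim_quotient_eq_ringKrullDim]
    exact Module.supportDim_le_of_injective f hf
  exact (hpn.trans hle).not_gt hdim
end
end

section
/- Let R be a commutative Noetherian ring, a an ideal of R, M a finitely generated R-module, and s a non-negative integer. If x_1, ..., x_s ∈ a is an M-regular sequence, then f_a(M) ≤ s + f_a(M/(x_1,...,x_s)M). -/
open CategoryTheory

noncomputable section

open Limits Opposite

namespace CategoryTheory.NatTrans

section LeftDerived

universe v u v₂ u₂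

variable {C : Type u} [Category.{v} C] [Abelian C]
  {D : Type u₂} [Category.{v₂} D] [Abelian D]
  {F G H : C ⥤ D} [F.Additive] [G.Additive] [H.Additive] {α : F ⟶ G} {β : G ⟶ H}
  (w : α ≫ β = 0)

/-- Two composable natural transformations with zero composition, applied to a chain complex. -/
def mapShortComplex (K : ChainComplex C ℕ) : ShortComplex (ChainComplex D ℕ) where
  X₁ := (F.mapHomologicalComplex _).obj K
  X₂ := (G.mapHomologicalComplex _).obj K
  X₃ := (H.mapHomologicalComplex _).obj K
  f := (NatTrans.mapHomologicalComplex α _).app K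
  g := (NatTrans.mapHomologicalComplex β _).app K
  zero := by
    ext i
    exact congr_app w (K.X i)

/-- The functoriality of `mapShortComplex` in the chain complex. -/
def mapShortComplexMap {K L : ChainComplex C ℕ} (φ : K ⟶ L) :
    mapShortComplex w K ⟶ mapShortComplex w L where
  τ₁ := (F.mapHomologicalComplex _).map φ
  τ₂ := (G.mapHomologicalComplex _).map φ
  τ₃ := (H.mapHomologicalComplex _).map φ
  comm₁₂ := (NatTrans.mapHomologicalComplex α _).naturality φ
  comm₂₃ := (NatTrans.mapHomologicalComplex β _).naturality φ

variable (hS : ∀ (P : C) [Projective P],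
  (ShortComplex.mk (α.app P) (β.app P) (congr_app w P)).ShortExact)

include hS in
lemma mapShortComplex_shortExact {X : C} (P : ProjectiveResolution X) :
    (mapShortComplex w P.complex).ShortExact :=
  HomologicalComplex.shortExact_of_degreewise_shortExact _ fun i => hS (P.complex.X i)

/-- The connecting morphism in homology after applying a sequence of functors which is exact on
projective objects to a projective resolution. -/
def resolutionδ {X : C} (P : ProjectiveResolution X) (n : ℕ) :
    (H.mapHomologicalComplex _ ⋙ HomologicalComplex.homologyFunctor D _ (n + 1)).obj P.complex ⟶
      (F.mapHomologicalComplex _ ⋙ HomologicalComplex.homologyFunctor D _ n).obj P.complex :=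
  (mapShortComplex_shortExact w hS P).δ (n + 1) n rfl

lemma resolutionδ_naturality {X Y : C} {P : ProjectiveResolution X} {Q : ProjectiveResolution Y}
    (φ : P.complex ⟶ Q.complex) (n : ℕ) :
    resolutionδ w hS P n ≫
        (F.mapHomologicalComplex _ ⋙ HomologicalComplex.homologyFunctor D _ n).map φ =
      (H.mapHomologicalComplex _ ⋙ HomologicalComplex.homologyFunctor D _ (n + 1)).map φ ≫
        resolutionδ w hS Q n :=
  HomologicalComplex.HomologySequence.δ_naturality (mapShortComplexMap w φ)
    (mapShortComplex_shortExact w hS P) (mapShortComplex_shortExact w hS Q) (n + 1) n rfl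

lemma resolutionδ_comp {X : C} (P : ProjectiveResolution X) (n : ℕ) :
    resolutionδ w hS P n ≫ (HomologicalComplex.homologyFunctor D _ n).map
      ((NatTrans.mapHomologicalComplex α _).app P.complex) = 0 :=
  (mapShortComplex_shortExact w hS P).δ_comp (n + 1) n rfl

lemma resolutionδ_exact {X : C} (P : ProjectiveResolution X) (n : ℕ) :
    (ShortComplex.mk _ _ (resolutionδ_comp w hS P n)).Exact :=
  (mapShortComplex_shortExact w hS P).homology_exact₁ (n + 1) n rfl

variable [HasProjectiveResolutions C]

/-- The connecting natural transformation between left derived functors attached to a sequence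
of additive functors which is short exact on projective objects. -/
def leftDerivedδ (n : ℕ) : H.leftDerived (n + 1) ⟶ F.leftDerived n where
  app X := ((projectiveResolution X).isoLeftDerivedObj H (n + 1)).hom ≫
    resolutionδ w hS (projectiveResolution X) n ≫
      ((projectiveResolution X).isoLeftDerivedObj F n).inv
  naturality X Y f := by
    have hφ := ProjectiveResolution.lift_commutes f (projectiveResolution X)
      (projectiveResolution Y)
    rw [Functor.leftDerived_map_eq H (n + 1) f _ hφ, Functor.leftDerived_map_eq F n f _ hφ]
    simp only [Category.assoc]
    rw [Iso.inv_hom_id_assoc, Iso.inv_hom_id_assoc, ← Category.assoc (resolutionδ w hS _ n),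
      resolutionδ_naturality, Category.assoc]

lemma leftDerivedδ_comp (n : ℕ) :
    leftDerivedδ w hS n ≫ NatTrans.leftDerived α n = 0 := by
  ext X
  rw [comp_app, ProjectiveResolution.leftDerived_app_eq α (projectiveResolution X) n]
  dsimp only [leftDerivedδ]
  simp only [Category.assoc]
  rw [Iso.inv_hom_id_assoc, ← Category.assoc (resolutionδ w hS _ n), resolutionδ_comp]
  simp

lemma leftDerivedδ_exact (n : ℕ) (X : C) :
    (ShortComplex.mk ((leftDerivedδ w hS n).app X) ((NatTrans.leftDerived α n).app X)
      (congr_app (leftDerivedδ_comp w hS n) X)).Exact := by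
  let P := projectiveResolution X
  refine (ShortComplex.exact_iff_of_iso (ShortComplex.isoMk (P.isoLeftDerivedObj H (n + 1))
    (P.isoLeftDerivedObj F n) (P.isoLeftDerivedObj G n) ?_ ?_)).2 (resolutionδ_exact w hS P n)
  · dsimp only [leftDerivedδ]
    rw [Category.assoc, Category.assoc, Iso.inv_hom_id, Category.comp_id]
  · dsimp only
    rw [ProjectiveResolution.leftDerived_app_eq α P n, Category.assoc, Category.assoc,
      Iso.inv_hom_id, Category.comp_id]

end LeftDerived

end CategoryTheory.NatTrans

lemma CategoryTheory.ShortComplex.exact_of_evaluation {J C : Type*} [Category* J] [Category* C]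
    [Abelian C] {S : ShortComplex (J ⥤ C)}
    (h : ∀ j, (S.map ((evaluation J C).obj j)).Exact) : S.Exact := by
  rw [exact_iff_isZero_homology, Functor.isZero_iff]
  exact fun j => ((exact_iff_isZero_homology _).1 (h j)).of_iso
    (S.mapHomologyIso ((evaluation J C).obj j)).symm

section Ext

universe v u

variable {R : Type*} [Ring R] {C : Type u} [Category.{v} C] [Abelian C] [Linear R C]

lemma linearYoneda_rightOp_comp (S : ShortComplex C) :
    NatTrans.rightOp ((linearYoneda R C).map S.g) ≫
      NatTrans.rightOp ((linearYoneda R C).map S.f) = 0 := by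
  ext P
  apply Quiver.Hom.unop_inj
  ext x
  exact (Category.assoc _ _ _).trans ((congrArg (_ ≫ ·) S.zero).trans Limits.comp_zero)

lemma linearYoneda_rightOp_shortExact {S : ShortComplex C} (hS : S.ShortExact) (P : C)
    [Projective P] :
    (ShortComplex.mk ((NatTrans.rightOp ((linearYoneda R C).map S.g)).app P)
      ((NatTrans.rightOp ((linearYoneda R C).map S.f)).app P)
      (congr_app (linearYoneda_rightOp_comp S) P)).ShortExact := by
  have := hS.mono_f
  have := hS.epi_g
  refine ShortComplex.ShortExact.op (S := ShortComplex.mk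
    (((linearYoneda R C).map S.f).app (op P)) (((linearYoneda R C).map S.g).app (op P)) ?_) ?_
  · exact congrArg Quiver.Hom.unop (congr_app (linearYoneda_rightOp_comp S) P)
  · refine @ShortComplex.ShortExact.mk _ _ _ _ ?_ ?_ ?_
    · rw [ShortComplex.moduleCat_exact_iff]
      intro (x : P ⟶ S.X₂) (hx : x ≫ S.g = 0)
      exact ⟨hS.exact.lift x hx, hS.exact.lift_f x hx⟩
    · rw [ModuleCat.mono_iff_injective]
      exact fun (x y : P ⟶ S.X₁) (h : x ≫ S.f = y ≫ S.f) => (cancel_mono S.f).1 h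
    · rw [ModuleCat.epi_iff_surjective]
      exact fun (x : P ⟶ S.X₃) => ⟨Projective.factorThru x S.g, Projective.factorThru_comp x S.g⟩

variable [EnoughProjectives C]

/-- The connecting morphism `Ext^n(-, S.X₃) ⟶ Ext^(n+1)(-, S.X₁)` of a short exact sequence `S`. -/
def extδ {S : ShortComplex C} (hS : S.ShortExact) (n : ℕ) :
    (Ext R C n).flip.obj S.X₃ ⟶ (Ext R C (n + 1)).flip.obj S.X₁ :=
  NatTrans.leftOp (NatTrans.leftDerivedδ (linearYoneda_rightOp_comp (R := R) S)
    (linearYoneda_rightOp_shortExact hS) n)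

lemma ext_map_comp_extδ {S : ShortComplex C} (hS : S.ShortExact) (n : ℕ) :
    (Ext R C n).flip.map S.g ≫ extδ hS n = 0 := by
  have := NatTrans.leftDerivedδ_comp (linearYoneda_rightOp_comp (R := R) S)
    (linearYoneda_rightOp_shortExact hS) n
  ext X : 2
  exact congrArg Quiver.Hom.unop (congr_app this X.unop)

lemma ext_exact {S : ShortComplex C} (hS : S.ShortExact) (n : ℕ) :
    (ShortComplex.mk _ _ (ext_map_comp_extδ (R := R) hS n)).Exact :=
  ShortComplex.exact_of_evaluation fun X =>
    (NatTrans.leftDerivedδ_exact (linearYoneda_rightOp_comp (R := R) S)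
      (linearYoneda_rightOp_shortExact hS) n X.unop).unop

end Ext

section LocalCohomology

open localCohomology

variable {R : Type} [CommRing R]

/-- Local cohomology of a fixed module as a colimit in the category of modules. -/
def localCohomologyObjIso (a : Ideal R) (i : ℕ) (M : ModuleCat R) :
    (localCohomology a i).obj M ≅ colimit ((ringModIdeals (idealPowersDiagram a)).op ⋙
      (Ext R (ModuleCat R) i).flip.obj M) :=
  colimitObjIsoColimitCompEvaluation (diagram (idealPowersDiagram a) i) M

lemma finite_localCohomology_of_shortExact [IsNoetherianRing R] (a : Ideal R)
    {S : ShortComplex (ModuleCat R)} (hS : S.ShortExact) (i : ℕ)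
    [Module.Finite R ((localCohomology a i).obj S.X₂)]
    [Module.Finite R ((localCohomology a (i + 1)).obj S.X₁)] :
    Module.Finite R ((localCohomology a i).obj S.X₃) := by
  have h := ((ext_exact (R := R) hS i).map
    ((Functor.whiskeringLeft _ _ (ModuleCat R)).obj
      (ringModIdeals (idealPowersDiagram a)).op)).map colim
  have h₁ : IsNoetherian R ↑(colimit ((ringModIdeals (idealPowersDiagram a)).op ⋙
      (Ext R (ModuleCat R) i).flip.obj S.X₂)) :=
    isNoetherian_of_linearEquiv (localCohomologyObjIso a i S.X₂).toLinearEquiv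
  have h₂ : IsNoetherian R ↑(colimit ((ringModIdeals (idealPowersDiagram a)).op ⋙
      (Ext R (ModuleCat R) (i + 1)).flip.obj S.X₁)) :=
    isNoetherian_of_linearEquiv (localCohomologyObjIso a (i + 1) S.X₁).toLinearEquiv
  have h₃ : IsNoetherian R ↑(colimit ((ringModIdeals (idealPowersDiagram a)).op ⋙
      (Ext R (ModuleCat R) i).flip.obj S.X₃)) :=
    @isNoetherian_of_range_eq_ker _ _ _ _ _ _ _ _ _ _ _ h₁ h₂ _ _ h.moduleCat_range_eq_ker
  exact Module.Finite.equiv (localCohomologyObjIso a i S.X₃).toLinearEquiv.symm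

lemma finDim_congr (a : Ideal R) {M N : Type} [AddCommGroup M] [Module R M]
    [AddCommGroup N] [Module R N] (e : M ≃ₗ[R] N) : finDim R a M = finDim R a N := by
  have (i : ℕ) : Module.Finite R ↥(locCoh R a i M) ↔ Module.Finite R ↥(locCoh R a i N) :=
    Module.Finite.equiv_iff ((localCohomology a i).mapIso e.toModuleIso).toLinearEquiv
  simp only [finDim, this]

lemma finDim_le_one_add_finDim_quotSMulTop [IsNoetherianRing R] (a : Ideal R)
    (M : Type) [AddCommGroup M] [Module R M] {x : R} (hx : IsSMulRegular M x) :
    finDim R a M ≤ 1 + finDim R a (QuotSMulTop x M) := by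
  have hS := IsSMulRegular.smulShortComplex_shortExact (M := ModuleCat.of R M) hx
  rcases Set.eq_empty_or_nonempty {i : ℕ | ¬ Module.Finite R ↥(locCoh R a i (QuotSMulTop x M))}
    with h | h
  · simp [finDim, h]
  obtain ⟨i, hi, hi₂⟩ : finDim R a (QuotSMulTop x M) ∈ _ := csInf_mem (h.image Nat.cast)
  rw [← hi₂]
  by_cases h₂ : Module.Finite R ↥(locCoh R a i M)
  · have h₁ : ¬ Module.Finite R ↥(locCoh R a (i + 1) M) := fun h₁ =>
      hi (@finite_localCohomology_of_shortExact R _ _ a _ hS i h₂ h₁)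
    refine (sInf_le (Set.mem_image_of_mem _ h₁)).trans ?_
    push_cast
    rw [add_comm]
  · exact (sInf_le (Set.mem_image_of_mem _ h₂)).trans le_add_self

lemma finDim_le_length_add [IsNoetherianRing R] (a : Ideal R) (rs : List R) (M : Type)
    [AddCommGroup M] [Module R M] (h : RingTheory.Sequence.IsWeaklyRegular M rs) :
    finDim R a M ≤ rs.length + finDim R a (M ⧸ (Ideal.ofList rs • ⊤ : Submodule R M)) := by
  induction rs generalizing M with
  | nil =>
    rw [finDim_congr a (Submodule.quotEquivOfEqBot (Ideal.ofList [] • ⊤ : Submodule R M) (by simp))]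
    simp
  | cons x rs ih =>
    obtain ⟨hx, hrs⟩ := (RingTheory.Sequence.isWeaklyRegular_cons_iff M x rs).1 h
    rw [finDim_congr a (Submodule.quotOfListConsSMulTopEquivQuotSMulTopInner M x rs)]
    refine (finDim_le_one_add_finDim_quotSMulTop a M hx).trans ?_
    rw [List.length_cons, Nat.cast_succ, add_comm (rs.length : ℕ∞), add_assoc]
    exact add_le_add_right (ih _ hrs) 1

end LocalCohomology

/-- If `x_1, …, x_s ∈ a` is an `M`-regular sequence, then
`f_a(M) ≤ s + f_a(M/(x_1,…,x_s)M)`. -/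
theorem finDim_le_of_isRegular (R : Type) [CommRing R] [IsNoetherianRing R] (a : Ideal R)
    (M : Type) [AddCommGroup M] [Module R M] [Module.Finite R M]
    (s : ℕ) (rs : List R) (hlen : rs.length = s) (hmem : ∀ x ∈ rs, x ∈ a)
    (hreg : RingTheory.Sequence.IsRegular M rs) :
    finDim R a M ≤ (s : ℕ∞) + finDim R a (M ⧸ (Ideal.ofList rs • ⊤ : Submodule R M)) := by
  subst hlen
  exact finDim_le_length_add a rs M hreg.toIsWeaklyRegular
end
end
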